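/- arXiv:2502.11622 — 3 statements merged into one kernel-verified Lean document; each statement's English description precedes it below -/
import Mathlib

section
/- A countable discrete group Γ is exact if and only if the closure of the set of finite IREs on Γ, taken in the weak topology on Borel probability measures on E, equals the set of amenable IREs on Γ. -/
open MeasureTheory Filter Topology

/-- A function `r : Γ × Γ → Bool` codes an equivalence relation on `Γ`. -/
def IsEqRel {Γ : Type*} (r : Γ × Γ → Bool) : Prop :=
  (∀ x, r (x, x) = true) ∧ (∀ x y, r (x, y) = true → r (y, x) = true) ∧
    (∀ x y z, r (x, y) = true → r (y, z) = true → r (x, z) = true)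

/-- The space `E` of equivalence relations on `Γ`, as a subspace of `{0,1}^{Γ×Γ}`. -/
abbrev EqRelSpace (Γ : Type*) : Type _ := ↥{r : Γ × Γ → Bool | IsEqRel r}

variable {Γ : Type*} [Group Γ]

/-- The left shift action of `Γ` on the space of equivalence relations:
`(γ·r)(x,y) = r(γ⁻¹x, γ⁻¹y)`. -/
def shiftE (γ : Γ) (r : EqRelSpace Γ) : EqRelSpace Γ :=
  ⟨fun p => r.1 (γ⁻¹ * p.1, γ⁻¹ * p.2),
    ⟨fun _ => r.2.1 _, fun _ _ h => r.2.2.1 _ _ h, fun _ _ _ h h' => r.2.2.2 _ _ _ h h'⟩⟩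

/-- The `r`-class of `g ∈ Γ`. -/
def classOf (r : EqRelSpace Γ) (g : Γ) : Set Γ := {h | r.1 (g, h) = true}

/-- An invariant random equivalence relation: a Borel probability measure on `E`
invariant under the left shift action. -/
def IsIRE (ρ : ProbabilityMeasure (EqRelSpace Γ)) : Prop :=
  ∀ γ : Γ, ρ.toMeasure.map (shiftE γ) = ρ.toMeasure

/-- A finite IRE: almost every equivalence relation has all classes finite. -/
def IsFIRE (ρ : ProbabilityMeasure (EqRelSpace Γ)) : Prop :=
  IsIRE ρ ∧ ∀ᵐ r ∂ρ.toMeasure, ∀ g : Γ, (classOf r g).Finite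

/-- An amenable IRE: there are Borel maps `λ_n : E → Prob(Γ)` (coded coordinatewise as
`lam : ℕ → E → Γ → ℝ`) such that for a.e. `r` and every `g` in the class of the identity,
`‖g⁻¹·λ_n^r − λ_n^{g⁻¹·r}‖₁ → 0`; here `(g⁻¹·λ_n^r)(h) = λ_n^r(gh)`. -/
def IsAIRE (ρ : ProbabilityMeasure (EqRelSpace Γ)) : Prop :=
  IsIRE ρ ∧ ∃ lam : ℕ → EqRelSpace Γ → Γ → ℝ,
    (∀ n g, Measurable fun r => lam n r g) ∧
    (∀ n r g, 0 ≤ lam n r g) ∧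
    (∀ n r, ∑' g, lam n r g = 1) ∧
    ∀ᵐ r ∂ρ.toMeasure, ∀ g ∈ classOf r 1,
      Tendsto (fun n => ∑' h : Γ, |lam n r (g * h) - lam n (shiftE g⁻¹ r) h|) atTop (𝓝 0)

/-- Topological amenability of an action `a : Γ → X → X` on a topological space:
there are continuous maps `η_n : X → Prob(Γ)` (coded coordinatewise) with
`sup_x ‖γ·η_n^x − η_n^{γ·x}‖₁ → 0` for every `γ`; here `(γ·η)(g) = η(γ⁻¹g)`. -/
def TopAmenableAction (Γ : Type*) [Group Γ] {X : Type*} [TopologicalSpace X]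
    (a : Γ → X → X) : Prop :=
  ∃ η : ℕ → X → Γ → ℝ,
    (∀ n x g, 0 ≤ η n x g) ∧
    (∀ n x, ∑' g, η n x g = 1) ∧
    (∀ n g, Continuous fun x => η n x g) ∧
    ∀ γ : Γ, ∀ ε > (0 : ℝ), ∃ N, ∀ n ≥ N, ∀ x : X,
      ∑' g : Γ, |η n x (γ⁻¹ * g) - η n (a γ x) g| < ε

/-- A countable group is exact iff it admits a topologically amenable continuous action
on a nonempty compact metrizable space. -/
def IsExactGroup (Γ : Type*) [Group Γ] : Prop :=
  ∃ (X : Type) (_ : TopologicalSpace X) (a : Γ → X → X),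
    Nonempty X ∧ CompactSpace X ∧ TopologicalSpace.MetrizableSpace X ∧
    (∀ x, a 1 x = x) ∧ (∀ γ δ x, a (γ * δ) x = a γ (a δ x)) ∧
    (∀ γ, Continuous (a γ)) ∧ TopAmenableAction Γ a

set_option linter.unusedSectionVars false

open scoped ENNReal

section Shift

theorem shiftE_apply (γ : Γ) (r : EqRelSpace Γ) (x y : Γ) :
    (shiftE γ r).1 (x, y) = r.1 (γ⁻¹ * x, γ⁻¹ * y) := rfl

theorem shiftE_mul (γ δ : Γ) (r : EqRelSpace Γ) :
    shiftE (γ * δ) r = shiftE γ (shiftE δ r) := by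
  apply Subtype.ext
  funext p
  simp [shiftE, mul_assoc]

@[simp] theorem shiftE_one (r : EqRelSpace Γ) : shiftE 1 r = r := by
  apply Subtype.ext
  funext p
  simp [shiftE]

theorem continuous_shiftE (γ : Γ) : Continuous (shiftE γ : EqRelSpace Γ → EqRelSpace Γ) := by
  refine Continuous.subtype_mk ?_ _
  exact continuous_pi fun p =>
    (continuous_apply (γ⁻¹ * p.1, γ⁻¹ * p.2)).comp continuous_subtype_val

@[fun_prop]
theorem measurable_shiftE (γ : Γ) : Measurable (shiftE γ : EqRelSpace Γ → EqRelSpace Γ) := by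
  refine Measurable.subtype_mk ?_
  exact measurable_pi_iff.2 fun p =>
    (measurable_pi_apply (γ⁻¹ * p.1, γ⁻¹ * p.2)).comp measurable_subtype_coe

theorem measurableSet_related (x y : Γ) :
    MeasurableSet {r : EqRelSpace Γ | r.1 (x, y) = true} := by
  have h : Measurable fun r : EqRelSpace Γ => r.1 (x, y) :=
    (measurable_pi_apply (x, y)).comp measurable_subtype_coe
  exact h (measurableSet_singleton true)

theorem IsIRE.measurePreserving {ρ : ProbabilityMeasure (EqRelSpace Γ)} (hρ : IsIRE ρ) (γ : Γ) :
    MeasurePreserving (shiftE γ) ρ.toMeasure ρ.toMeasure :=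
  ⟨measurable_shiftE γ, hρ γ⟩

/-- The left shift on real-valued labellings of the group. -/
def shiftLabel (γ : Γ) (u : Γ → ℝ) : Γ → ℝ := fun x => u (γ⁻¹ * x)

@[fun_prop]
theorem measurable_shiftLabel (γ : Γ) : Measurable (shiftLabel γ : (Γ → ℝ) → Γ → ℝ) :=
  measurable_pi_iff.2 fun x => measurable_pi_apply (γ⁻¹ * x)

end Shift

section Labels

/-- The uniform distribution on `[0, 1]`. -/
noncomputable def unifLaw : Measure ℝ := volume.restrict (Set.Icc 0 1)

instance : IsProbabilityMeasure unifLaw := by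
  constructor
  simp [unifLaw]

theorem unifLaw_Iio_le (t : ℝ) : unifLaw (Set.Iio t) ≤ ENNReal.ofReal t := by
  rw [unifLaw, Measure.restrict_apply measurableSet_Iio]
  calc _ ≤ volume (Set.Ico 0 t) := measure_mono fun x hx => ⟨hx.2.1, hx.1⟩
    _ = _ := by simp

theorem unifLaw_Iio {t : ℝ} (ht : t ≤ 1) : unifLaw (Set.Iio t) = ENNReal.ofReal t := by
  rw [unifLaw, Measure.restrict_apply measurableSet_Iio]
  have : Set.Iio t ∩ Set.Icc 0 1 = Set.Ico 0 t := by
    ext x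
    simp only [Set.mem_inter_iff, Set.mem_Iio, Set.mem_Icc, Set.mem_Ico]
    constructor
    · rintro ⟨h1, h2, h3⟩
      exact ⟨h2, h1⟩
    · rintro ⟨h1, h2⟩
      exact ⟨h2, h1, by linarith⟩
  rw [this]
  simp

theorem unifLaw_Ico_le (a b : ℝ) : unifLaw (Set.Ico a b) ≤ ENNReal.ofReal (b - a) := by
  rw [unifLaw]
  exact (Measure.restrict_apply_le _ _).trans (by simp)

theorem unifLaw_Ici_le (t : ℝ) : unifLaw (Set.Ici t) ≤ ENNReal.ofReal (Real.exp (-t)) := by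
  rw [unifLaw, Measure.restrict_apply measurableSet_Ici]
  calc _ ≤ volume (Set.Icc t 1) := measure_mono fun x hx => ⟨hx.1, hx.2.2⟩
    _ ≤ _ := by
      rw [Real.volume_Icc]
      apply ENNReal.ofReal_le_ofReal
      linarith [Real.add_one_le_exp (-t)]

/-- Independent uniform labels indexed by the group. -/
noncomputable def labelLaw (Γ : Type*) : Measure (Γ → ℝ) := Measure.infinitePi fun _ => unifLaw

instance : IsProbabilityMeasure (labelLaw Γ) := by
  unfold labelLaw
  infer_instance


theorem measurePreserving_eval_labelLaw (x : Γ) :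
    MeasurePreserving (fun u : Γ → ℝ => u x) (labelLaw Γ) unifLaw :=
  measurePreserving_eval_infinitePi (fun _ : Γ => unifLaw) x

theorem measurePreserving_shiftLabel (γ : Γ) :
    MeasurePreserving (shiftLabel γ) (labelLaw Γ) (labelLaw Γ) := by
  refine ⟨measurable_shiftLabel γ, ?_⟩
  have h := Measure.infinitePi_map_piCongrLeft (fun _ : Γ => unifLaw) (Equiv.mulLeft γ)
  have h2 : (MeasurableEquiv.piCongrLeft (fun _ : Γ => ℝ) (Equiv.mulLeft γ) :
      (Γ → ℝ) → (Γ → ℝ)) = shiftLabel γ := by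
    funext u x
    obtain ⟨y, rfl⟩ := (Equiv.mulLeft γ).surjective x
    rw [MeasurableEquiv.coe_piCongrLeft, Equiv.piCongrLeft_apply_apply]
    simp [shiftLabel]
  rw [h2] at h
  exact h

end Labels

section Thinning

/-- The sites accepted by `g` when the site `x` carries the label `u x` and the acceptance
thresholds are given by the equivariant field generated by `f`. -/
def acceptSet (f : EqRelSpace Γ → Γ → ℝ) (r : EqRelSpace Γ) (u : Γ → ℝ) (g : Γ) : Set Γ :=
  {x | u x < f (shiftE g⁻¹ r) (g⁻¹ * x)}

theorem mem_acceptSet_shift (f : EqRelSpace Γ → Γ → ℝ) (r : EqRelSpace Γ) (u : Γ → ℝ)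
    (γ g x : Γ) :
    x ∈ acceptSet f (shiftE γ r) (shiftLabel γ u) g ↔
      γ⁻¹ * x ∈ acceptSet f r u (γ⁻¹ * g) := by
  simp only [acceptSet, shiftLabel, Set.mem_ofPred_eq, ← shiftE_mul, mul_inv_rev, inv_inv,
    mul_assoc, mul_inv_cancel_left]

theorem acceptSet_shift (f : EqRelSpace Γ → Γ → ℝ) (r : EqRelSpace Γ) (u : Γ → ℝ) (γ g : Γ) :
    acceptSet f (shiftE γ r) (shiftLabel γ u) g =
      (fun x => γ⁻¹ * x) ⁻¹' acceptSet f r u (γ⁻¹ * g) := by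
  ext x
  exact mem_acceptSet_shift f r u γ g x

open Classical in
/-- The subrelation of `r` joining elements that accept the same nonempty set of sites. -/
noncomputable def thin (f : EqRelSpace Γ → Γ → ℝ) (p : EqRelSpace Γ × (Γ → ℝ)) : EqRelSpace Γ :=
  ⟨fun q => decide (q.1 = q.2 ∨ (p.1.1 q = true ∧ acceptSet f p.1 p.2 q.1 = acceptSet f p.1 p.2 q.2
      ∧ (acceptSet f p.1 p.2 q.1).Nonempty)), by
    refine ⟨fun x => by simp, fun x y h => ?_, fun x y z h h' => ?_⟩
    · rw [decide_eq_true_iff] at h ⊢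
      rcases h with h | ⟨h1, h2, h3⟩
      · exact Or.inl h.symm
      · exact Or.inr ⟨p.1.2.2.1 _ _ h1, h2.symm, h2 ▸ h3⟩
    · rw [decide_eq_true_iff] at h h' ⊢
      rcases h with h | ⟨h1, h2, h3⟩
      · simp only at h
        subst h
        exact h'
      · rcases h' with h' | ⟨h1', h2', h3'⟩
        · simp only at h'
          subst h'
          exact Or.inr ⟨h1, h2, h3⟩
        · exact Or.inr ⟨p.1.2.2.2 _ _ _ h1 h1', h2.trans h2', h3⟩⟩

theorem thin_apply (f : EqRelSpace Γ → Γ → ℝ) (r : EqRelSpace Γ) (u : Γ → ℝ) (x y : Γ) :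
    (thin f (r, u)).1 (x, y) = true ↔ x = y ∨ (r.1 (x, y) = true ∧
      acceptSet f r u x = acceptSet f r u y ∧ (acceptSet f r u x).Nonempty) := by
  simp [thin]

theorem thin_shift (f : EqRelSpace Γ → Γ → ℝ) (γ : Γ) (r : EqRelSpace Γ) (u : Γ → ℝ) :
    thin f (shiftE γ r, shiftLabel γ u) = shiftE γ (thin f (r, u)) := by
  apply Subtype.ext
  funext q
  obtain ⟨x, y⟩ := q
  rw [Bool.eq_iff_iff, shiftE_apply, thin_apply, thin_apply, acceptSet_shift, acceptSet_shift,
    shiftE_apply]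
  have hs : Function.Surjective (fun x : Γ => γ⁻¹ * x) := (Equiv.mulLeft γ⁻¹).surjective
  rw [hs.preimage_injective.eq_iff, mul_right_inj, hs.nonempty_preimage]

variable [Countable Γ]

theorem measurableSet_mem_acceptSet {f : EqRelSpace Γ → Γ → ℝ}
    (hf : ∀ g, Measurable fun r => f r g) (g x : Γ) :
    MeasurableSet {p : EqRelSpace Γ × (Γ → ℝ) | x ∈ acceptSet f p.1 p.2 g} := by
  have h1 : Measurable fun p : EqRelSpace Γ × (Γ → ℝ) => p.2 x :=
    (measurable_pi_apply x).comp measurable_snd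
  have h2 : Measurable fun p : EqRelSpace Γ × (Γ → ℝ) => f (shiftE g⁻¹ p.1) (g⁻¹ * x) :=
    (hf (g⁻¹ * x)).comp ((measurable_shiftE g⁻¹).comp measurable_fst)
  exact measurableSet_lt h1 h2

theorem measurableSet_acceptSet_eq {f : EqRelSpace Γ → Γ → ℝ}
    (hf : ∀ g, Measurable fun r => f r g) (g h : Γ) :
    MeasurableSet {p : EqRelSpace Γ × (Γ → ℝ) |
      acceptSet f p.1 p.2 g = acceptSet f p.1 p.2 h} := by
  simp only [Set.ext_iff]
  rw [Set.ofPred_forall]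
  refine MeasurableSet.iInter fun x => ?_
  exact (measurableSet_mem_acceptSet hf g x).iff (measurableSet_mem_acceptSet hf h x)

theorem measurableSet_acceptSet_nonempty {f : EqRelSpace Γ → Γ → ℝ}
    (hf : ∀ g, Measurable fun r => f r g) (g : Γ) :
    MeasurableSet {p : EqRelSpace Γ × (Γ → ℝ) | (acceptSet f p.1 p.2 g).Nonempty} := by
  simp only [Set.Nonempty]
  rw [Set.ofPred_exists]
  exact MeasurableSet.iUnion fun x => measurableSet_mem_acceptSet hf g x

theorem measurable_thin {f : EqRelSpace Γ → Γ → ℝ} (hf : ∀ g, Measurable fun r => f r g) :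
    Measurable (thin f) := by
  refine Measurable.subtype_mk ?_
  refine measurable_pi_iff.2 fun q => measurable_to_bool ?_
  have h : (fun p : EqRelSpace Γ × (Γ → ℝ) => p.1.1 q) ⁻¹' {true} ∩
      ({p : EqRelSpace Γ × (Γ → ℝ) | acceptSet f p.1 p.2 q.1 = acceptSet f p.1 p.2 q.2} ∩
      {p : EqRelSpace Γ × (Γ → ℝ) | (acceptSet f p.1 p.2 q.1).Nonempty}) ∪
      {p : EqRelSpace Γ × (Γ → ℝ) | q.1 = q.2} = _ := rfl
  convert ((measurable_fst (measurableSet_related q.1 q.2)).inter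
    ((measurableSet_acceptSet_eq hf q.1 q.2).inter
      (measurableSet_acceptSet_nonempty hf q.1))).union
    (MeasurableSet.const (q.1 = q.2)) using 1
  ext p
  simp only [Set.mem_preimage, Set.mem_singleton_iff, decide_eq_true_iff, Set.mem_union,
    Set.mem_inter_iff, Set.mem_ofPred_eq]
  exact or_comm

theorem measurePreserving_shift_prod {ρ : ProbabilityMeasure (EqRelSpace Γ)} (hρ : IsIRE ρ)
    (γ : Γ) :
    MeasurePreserving (Prod.map (shiftE γ) (shiftLabel γ))
      (ρ.toMeasure.prod (labelLaw Γ)) (ρ.toMeasure.prod (labelLaw Γ)) :=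
  (hρ.measurePreserving γ).prod (measurePreserving_shiftLabel γ)

/-- The law of the thinned relation. -/
noncomputable def thinLaw (ρ : ProbabilityMeasure (EqRelSpace Γ)) {f : EqRelSpace Γ → Γ → ℝ}
    (hf : ∀ g, Measurable fun r => f r g) : ProbabilityMeasure (EqRelSpace Γ) :=
  ⟨(ρ.toMeasure.prod (labelLaw Γ)).map (thin f),
    Measure.isProbabilityMeasure_map (measurable_thin hf).aemeasurable⟩

theorem thinLaw_toMeasure (ρ : ProbabilityMeasure (EqRelSpace Γ)) {f : EqRelSpace Γ → Γ → ℝ}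
    (hf : ∀ g, Measurable fun r => f r g) :
    (thinLaw ρ hf).toMeasure = (ρ.toMeasure.prod (labelLaw Γ)).map (thin f) := rfl

theorem isIRE_thinLaw {ρ : ProbabilityMeasure (EqRelSpace Γ)} (hρ : IsIRE ρ)
    {f : EqRelSpace Γ → Γ → ℝ} (hf : ∀ g, Measurable fun r => f r g) : IsIRE (thinLaw ρ hf) := by
  intro γ
  rw [thinLaw_toMeasure, Measure.map_map (measurable_shiftE γ) (measurable_thin hf)]
  conv_rhs => rw [← (measurePreserving_shift_prod hρ γ).map_eq]
  rw [Measure.map_map (measurable_thin hf) (measurePreserving_shift_prod hρ γ).measurable]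
  congr 1
  funext p
  exact (thin_shift f γ p.1 p.2).symm

theorem measure_mem_acceptSet_le (ρ : ProbabilityMeasure (EqRelSpace Γ))
    {f : EqRelSpace Γ → Γ → ℝ} (hf : ∀ g, Measurable fun r => f r g) (g x : Γ) :
    (ρ.toMeasure.prod (labelLaw Γ)) {p | x ∈ acceptSet f p.1 p.2 g} ≤
      ∫⁻ r, ENNReal.ofReal (f (shiftE g⁻¹ r) (g⁻¹ * x)) ∂ρ.toMeasure := by
  rw [Measure.prod_apply (measurableSet_mem_acceptSet hf g x)]
  refine lintegral_mono fun r => ?_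
  have := (measurePreserving_eval_labelLaw x).measure_preimage
    (s := Set.Iio (f (shiftE g⁻¹ r) (g⁻¹ * x))) measurableSet_Iio.nullMeasurableSet
  calc _ = _ := this
    _ ≤ _ := unifLaw_Iio_le _

theorem isFIRE_thinLaw {ρ : ProbabilityMeasure (EqRelSpace Γ)} (hρ : IsIRE ρ)
    {f : EqRelSpace Γ → Γ → ℝ} (hf : ∀ g, Measurable fun r => f r g) {T : ℝ≥0∞} (hT : T ≠ ∞)
    (hfT : ∀ r, ∑' x, ENNReal.ofReal (f r x) ≤ T) : IsFIRE (thinLaw ρ hf) := by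
  refine ⟨isIRE_thinLaw hρ hf, ?_⟩
  have hfin : ∀ x : Γ, ∀ᵐ p ∂(ρ.toMeasure.prod (labelLaw Γ)),
      {g | x ∈ acceptSet f p.1 p.2 g}.Finite := by
    intro x
    refine ae_finite_setOfPred_mem (s := fun g => {p : EqRelSpace Γ × (Γ → ℝ) |
      x ∈ acceptSet f p.1 p.2 g}) ?_
    refine ne_top_of_le_ne_top hT ?_
    calc _ ≤ ∑' g, ∫⁻ r, ENNReal.ofReal (f (shiftE g⁻¹ r) (g⁻¹ * x)) ∂ρ.toMeasure :=
          ENNReal.tsum_le_tsum fun g => measure_mem_acceptSet_le ρ hf g x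
      _ = ∑' g, ∫⁻ r, ENNReal.ofReal (f r (g⁻¹ * x)) ∂ρ.toMeasure := by
          refine tsum_congr fun g => ?_
          exact (hρ.measurePreserving g⁻¹).lintegral_comp (hf (g⁻¹ * x)).ennreal_ofReal
      _ = ∫⁻ r, ∑' g, ENNReal.ofReal (f r (g⁻¹ * x)) ∂ρ.toMeasure :=
          (lintegral_tsum fun g => (hf (g⁻¹ * x)).ennreal_ofReal.aemeasurable).symm
      _ ≤ ∫⁻ _, T ∂ρ.toMeasure := by
          refine lintegral_mono fun r => le_trans (le_of_eq ?_) (hfT r)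
          exact ((Equiv.inv Γ).trans (Equiv.mulRight x)).tsum_eq
            (fun y => ENNReal.ofReal (f r y))
      _ = T := by simp
  rw [thinLaw_toMeasure]
  have hmeas : MeasurableSet {r : EqRelSpace Γ | ∀ g, (classOf r g).Finite} := by
    rw [Set.ofPred_forall]
    refine MeasurableSet.iInter fun g => ?_
    have : {r : EqRelSpace Γ | (classOf r g).Finite} =
        ⋃ F : Finset Γ, ⋂ h : Γ, {r : EqRelSpace Γ | r.1 (g, h) = true → h ∈ F} := by
      ext r
      simp only [Set.mem_ofPred_eq, Set.mem_iUnion, Set.mem_iInter]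
      constructor
      · intro h
        exact ⟨h.toFinset, fun x hx => h.mem_toFinset.2 hx⟩
      · rintro ⟨F, hF⟩
        exact F.finite_toSet.subset fun x hx => hF x hx
    rw [this]
    refine MeasurableSet.iUnion fun F => MeasurableSet.iInter fun h => ?_
    exact (measurableSet_related g h).imp (MeasurableSet.const _)
  rw [ae_map_iff (measurable_thin hf).aemeasurable hmeas]
  filter_upwards [ae_all_iff.2 hfin] with p hp g
  by_cases hne : (acceptSet f p.1 p.2 g).Nonempty
  · obtain ⟨x, hx⟩ := hne
    refine ((hp x).union (Set.finite_singleton g)).subset fun h hh => ?_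
    rcases (thin_apply f p.1 p.2 g h).1 hh with h1 | ⟨_, h1, _⟩
    · exact Or.inr h1.symm
    · left
      change x ∈ acceptSet f p.1 p.2 h
      rwa [← h1]
  · refine (Set.finite_singleton g).subset fun h hh => ?_
    rcases (thin_apply f p.1 p.2 g h).1 hh with h1 | ⟨_, _, h1⟩
    · exact h1.symm
    · exact absurd h1 hne

end Thinning

section Displacement

theorem summable_of_tsum_eq_one {α : Type*} {a : α → ℝ} (h : ∑' x, a x = 1) : Summable a := by
  by_contra hs
  rw [tsum_eq_zero_of_not_summable hs] at h
  exact zero_ne_one h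

theorem tsum_ofReal_eq_one {α : Type*} {a : α → ℝ} (h0 : ∀ x, 0 ≤ a x) (h : ∑' x, a x = 1) :
    ∑' x, ENNReal.ofReal (a x) = 1 := by
  rw [← ENNReal.ofReal_tsum_of_nonneg h0 (summable_of_tsum_eq_one h), h, ENNReal.ofReal_one]

/-- A measurable field of probability vectors on `Γ`. -/
structure IsProbField (l : EqRelSpace Γ → Γ → ℝ) : Prop where
  measurable : ∀ g, Measurable fun r => l r g
  nonneg : ∀ r g, 0 ≤ l r g
  tsum_eq : ∀ r, ∑' g, l r g = 1

/-- The `ℓ¹` distance between `g⁻¹ · l r` and `l (g⁻¹ · r)`. -/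
noncomputable def displacement (l : EqRelSpace Γ → Γ → ℝ) (g : Γ) (r : EqRelSpace Γ) : ℝ≥0∞ :=
  ∑' x, ENNReal.ofReal |l r (g * x) - l (shiftE g⁻¹ r) x|

theorem tsum_ofReal_abs_sub_le_two {α : Type*} {a b : α → ℝ} (ha : ∀ x, 0 ≤ a x)
    (hb : ∀ x, 0 ≤ b x) (ha1 : ∑' x, a x = 1) (hb1 : ∑' x, b x = 1) :
    ∑' x, ENNReal.ofReal |a x - b x| ≤ 2 := by
  calc _ ≤ ∑' x, (ENNReal.ofReal (a x) + ENNReal.ofReal (b x)) := by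
        refine ENNReal.tsum_le_tsum fun x => ?_
        rw [← ENNReal.ofReal_add (ha x) (hb x)]
        apply ENNReal.ofReal_le_ofReal
        have := abs_sub (a x) (b x)
        rwa [abs_of_nonneg (ha x), abs_of_nonneg (hb x)] at this
    _ = 2 := by
        rw [ENNReal.tsum_add, tsum_ofReal_eq_one ha ha1, tsum_ofReal_eq_one hb hb1]
        norm_num

theorem tsum_mul_left_eq {a : Γ → ℝ} (g : Γ) (h : ∑' x, a x = 1) : ∑' x, a (g * x) = 1 := by
  rw [← h]
  exact (Equiv.mulLeft g).tsum_eq a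

theorem IsProbField.displacement_le_two {l : EqRelSpace Γ → Γ → ℝ} (hl : IsProbField l)
    (g : Γ) (r : EqRelSpace Γ) : displacement l g r ≤ 2 :=
  tsum_ofReal_abs_sub_le_two (fun _ => hl.nonneg _ _) (fun _ => hl.nonneg _ _)
    (tsum_mul_left_eq g (hl.tsum_eq r)) (hl.tsum_eq _)

theorem summable_abs_sub {α : Type*} {a b : α → ℝ} (ha1 : ∑' x, a x = 1)
    (hb1 : ∑' x, b x = 1) : Summable fun x => |a x - b x| :=
  ((summable_of_tsum_eq_one ha1).sub (summable_of_tsum_eq_one hb1)).abs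

theorem IsProbField.displacement_eq {l : EqRelSpace Γ → Γ → ℝ} (hl : IsProbField l)
    (g : Γ) (r : EqRelSpace Γ) :
    displacement l g r = ENNReal.ofReal (∑' x, |l r (g * x) - l (shiftE g⁻¹ r) x|) := by
  rw [ENNReal.ofReal_tsum_of_nonneg (fun _ => abs_nonneg _)
    (summable_abs_sub (tsum_mul_left_eq g (hl.tsum_eq r)) (hl.tsum_eq _))]
  rfl

variable [Countable Γ]

theorem measurable_displacement {l : EqRelSpace Γ → Γ → ℝ}
    (hl : ∀ g, Measurable fun r => l r g) (g : Γ) :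
    Measurable (displacement l g) := by
  refine Measurable.tsum fun x => ?_
  have h : Measurable fun r => l r (g * x) - l (shiftE g⁻¹ r) x :=
    (hl _).sub ((hl x).comp (measurable_shiftE g⁻¹))
  exact (continuous_abs.measurable.comp h).ennreal_ofReal

theorem IsAIRE.exists_tendsto_lintegral {ρ : ProbabilityMeasure (EqRelSpace Γ)} (hρ : IsAIRE ρ) :
    ∃ lam : ℕ → EqRelSpace Γ → Γ → ℝ, (∀ n, IsProbField (lam n)) ∧
      ∀ g, Tendsto (fun n => ∫⁻ r in {r | r.1 (1, g) = true}, displacement (lam n) g r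
        ∂ρ.toMeasure) atTop (𝓝 0) := by
  obtain ⟨_, lam, hm, h0, h1, hlim⟩ := hρ
  have hl : ∀ n, IsProbField (lam n) := fun n => ⟨hm n, h0 n, h1 n⟩
  refine ⟨lam, hl, fun g => ?_⟩
  have := tendsto_lintegral_of_dominated_convergence
    (μ := ρ.toMeasure.restrict {r | r.1 (1, g) = true})
    (F := fun n r => displacement (lam n) g r) (f := fun _ => 0) (fun _ => 2)
    (fun n => measurable_displacement (hm n) g)
    (fun n => ae_of_all _ fun r => (hl n).displacement_le_two g r)
    (by simpa using ENNReal.mul_ne_top (by simp) (measure_ne_top _ _)) ?_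
  · simpa using this
  · rw [ae_restrict_iff' (measurableSet_related 1 g)]
    filter_upwards [hlim] with r hr hg
    have h2 := ENNReal.tendsto_ofReal (hr g hg)
    rw [ENNReal.ofReal_zero] at h2
    exact h2.congr fun n => ((hl n).displacement_eq g r).symm

end Displacement

section Closure

theorem tendsto_of_ae_eventually_eq {Ω : Type*} [MeasurableSpace Ω] [Countable Γ] {P : Measure Ω}
    [IsProbabilityMeasure P] {Φ : ℕ → Ω → EqRelSpace Γ} {Ψ : Ω → EqRelSpace Γ}
    (hΦ : ∀ n, Measurable (Φ n)) (hΨ : Measurable Ψ)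
    {ρ' : ℕ → ProbabilityMeasure (EqRelSpace Γ)} {ρ : ProbabilityMeasure (EqRelSpace Γ)}
    (hρ' : ∀ n, (ρ' n).toMeasure = P.map (Φ n)) (hρ : ρ.toMeasure = P.map Ψ)
    (h : ∀ q, ∀ᵐ ω ∂P, ∀ᶠ n in atTop, (Φ n ω).1 q = (Ψ ω).1 q) :
    Tendsto ρ' atTop (𝓝 ρ) := by
  rw [ProbabilityMeasure.tendsto_iff_forall_integral_tendsto]
  intro f
  rw [hρ, integral_map hΨ.aemeasurable f.continuous.aestronglyMeasurable]
  have : ∀ n, ∫ r, f r ∂(ρ' n).toMeasure = ∫ ω, f (Φ n ω) ∂P := fun n => by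
    rw [hρ' n, integral_map (hΦ n).aemeasurable f.continuous.aestronglyMeasurable]
  simp only [this]
  refine tendsto_integral_of_dominated_convergence (fun _ => ‖f‖)
    (fun n => f.continuous.aestronglyMeasurable.comp_measurable (hΦ n))
    (integrable_const _) (fun n => ae_of_all _ fun ω => f.norm_coe_le_norm _) ?_
  filter_upwards [ae_all_iff.2 h] with ω hω
  refine (f.continuous.tendsto _).comp ?_
  rw [tendsto_subtype_rng, tendsto_pi_nhds]
  exact fun q => tendsto_const_nhds.congr' ((hω q).mono fun n hn => hn.symm)

variable [Countable Γ]

theorem labelLaw_acceptSet_empty_le {l : EqRelSpace Γ → Γ → ℝ} (hl : IsProbField l) (T : ℝ)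
    (r : EqRelSpace Γ) :
    labelLaw Γ {u | ¬ (acceptSet (fun r x => T * l r x) r u 1).Nonempty} ≤
      ENNReal.ofReal (Real.exp (-T)) := by
  have key : ∀ J : Finset Γ,
      labelLaw Γ {u | ¬ (acceptSet (fun r x => T * l r x) r u 1).Nonempty} ≤
        ENNReal.ofReal (Real.exp (-(T * ∑ x ∈ J, l r x))) := by
    intro J
    calc _ ≤ labelLaw Γ (Set.pi J fun x => Set.Ici (T * l r x)) := by
          refine measure_mono fun u hu x _ => ?_
          rw [Set.mem_ofPred_eq, Set.not_nonempty_iff_eq_empty,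
            Set.eq_empty_iff_forall_notMem] at hu
          have := hu x
          simpa [acceptSet] using this
      _ = ∏ x ∈ J, unifLaw (Set.Ici (T * l r x)) :=
          Measure.infinitePi_pi _ fun x _ => measurableSet_Ici
      _ ≤ ∏ x ∈ J, ENNReal.ofReal (Real.exp (-(T * l r x))) :=
          Finset.prod_le_prod' fun x _ => unifLaw_Ici_le _
      _ = _ := by
          rw [← ENNReal.ofReal_prod_of_nonneg fun _ _ => (Real.exp_pos _).le, ← Real.exp_sum,
            Finset.sum_neg_distrib, Finset.mul_sum]
  have hs : Tendsto (fun J : Finset Γ => ∑ x ∈ J, l r x) atTop (𝓝 1) := by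
    have := (summable_of_tsum_eq_one (hl.tsum_eq r)).hasSum
    rwa [hl.tsum_eq r] at this
  have hc : Continuous fun t : ℝ => ENNReal.ofReal (Real.exp (-(T * t))) :=
    ENNReal.continuous_ofReal.comp (by fun_prop)
  have := (hc.tendsto 1).comp hs
  rw [mul_one] at this
  exact ge_of_tendsto' this key

theorem labelLaw_acceptSet_ne_le (l : EqRelSpace Γ → Γ → ℝ) {T : ℝ} (hT : 0 ≤ T)
    (r : EqRelSpace Γ) (k : Γ) :
    labelLaw Γ {u | acceptSet (fun r x => T * l r x) r u 1 ≠
      acceptSet (fun r x => T * l r x) r u k} ≤ ENNReal.ofReal T * displacement l k r := by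
  have hsub : {u | acceptSet (fun r x => T * l r x) r u 1 ≠
      acceptSet (fun r x => T * l r x) r u k} ⊆
      ⋃ x, (fun u : Γ → ℝ => u (k * x)) ⁻¹' Set.Ico (min (T * l r (k * x))
        (T * l (shiftE k⁻¹ r) x)) (max (T * l r (k * x)) (T * l (shiftE k⁻¹ r) x)) := by
    intro u hu
    by_contra hcon
    apply hu
    ext y
    simp only [Set.mem_iUnion, Set.mem_preimage, Set.mem_Ico, not_exists, not_and, not_lt] at hcon
    have h1 := hcon (k⁻¹ * y)
    rw [mul_inv_cancel_left] at h1
    simp only [acceptSet, Set.mem_ofPred_eq, inv_one, shiftE_one, one_mul]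
    constructor
    · intro h
      by_contra h'
      have := h1 ((min_le_right _ _).trans (not_lt.1 h'))
      exact absurd h (not_lt.2 ((le_max_left _ _).trans this))
    · intro h
      by_contra h'
      have := h1 ((min_le_left _ _).trans (not_lt.1 h'))
      exact absurd h (not_lt.2 ((le_max_right _ _).trans this))
  calc _ ≤ _ := measure_mono hsub
    _ ≤ ∑' x, labelLaw Γ ((fun u : Γ → ℝ => u (k * x)) ⁻¹' Set.Ico (min (T * l r (k * x))
        (T * l (shiftE k⁻¹ r) x)) (max (T * l r (k * x)) (T * l (shiftE k⁻¹ r) x))) :=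
        measure_iUnion_le _
    _ ≤ ∑' x, ENNReal.ofReal T * ENNReal.ofReal |l r (k * x) - l (shiftE k⁻¹ r) x| := by
        refine ENNReal.tsum_le_tsum fun x => ?_
        rw [(measurePreserving_eval_labelLaw (k * x)).measure_preimage
          measurableSet_Ico.nullMeasurableSet]
        refine (unifLaw_Ico_le _ _).trans (le_of_eq ?_)
        rw [max_sub_min_eq_abs', ← mul_sub, abs_mul, abs_of_nonneg hT, ENNReal.ofReal_mul hT]
    _ = _ := ENNReal.tsum_mul_left

theorem measure_thin_ne_le {l : EqRelSpace Γ → Γ → ℝ} (hl : IsProbField l) {T : ℝ} (hT : 0 ≤ T)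
    (ρ : ProbabilityMeasure (EqRelSpace Γ)) (k : Γ) :
    (ρ.toMeasure.prod (labelLaw Γ))
      {p | (thin (fun r x => T * l r x) p).1 (1, k) ≠ p.1.1 (1, k)} ≤
      ENNReal.ofReal (Real.exp (-T)) +
        ENNReal.ofReal T * ∫⁻ r in {r | r.1 (1, k) = true}, displacement l k r ∂ρ.toMeasure := by
  have hf : ∀ g, Measurable fun r => (fun r x => T * l r x) r g :=
    fun g => (hl.measurable g).const_mul T
  have hE := measurableSet_acceptSet_nonempty hf 1
  have hA := (measurableSet_acceptSet_eq hf 1 k).compl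
  have hR : MeasurableSet (Prod.fst ⁻¹' {r | r.1 (1, k) = true} : Set (EqRelSpace Γ × (Γ → ℝ))) :=
    measurable_fst (measurableSet_related 1 k)
  have hsub : {p : EqRelSpace Γ × (Γ → ℝ) | (thin (fun r x => T * l r x) p).1 (1, k) ≠ p.1.1 (1, k)}
      ⊆ {p | (acceptSet (fun r x => T * l r x) p.1 p.2 1).Nonempty}ᶜ ∪
      ({p | acceptSet (fun r x => T * l r x) p.1 p.2 1 =
        acceptSet (fun r x => T * l r x) p.1 p.2 k}ᶜ ∩ Prod.fst ⁻¹' {r | r.1 (1, k) = true}) := by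
    rintro ⟨r, u⟩ hp
    by_contra hcon
    apply hp
    rw [Bool.eq_iff_iff, thin_apply]
    simp only [Set.mem_union, Set.mem_inter_iff, Set.mem_compl_iff, Set.mem_ofPred_eq, not_or,
      not_not, Set.mem_preimage, not_and] at hcon
    constructor
    · rintro (h | h)
      · rw [← h]
        exact r.2.1 1
      · exact h.1
    · intro h
      refine Or.inr ⟨h, ?_, hcon.1⟩
      by_contra h'
      exact hcon.2 h' h
  refine (measure_mono hsub).trans ((measure_union_le _ _).trans (add_le_add ?_ ?_))
  · rw [Measure.prod_apply hE.compl]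
    calc _ ≤ ∫⁻ _, ENNReal.ofReal (Real.exp (-T)) ∂ρ.toMeasure :=
          lintegral_mono fun r => labelLaw_acceptSet_empty_le hl T r
      _ = _ := by simp
  · rw [Measure.prod_apply (hA.inter hR),
      ← lintegral_const_mul _ (measurable_displacement hl.measurable k),
      ← lintegral_indicator (measurableSet_related 1 k)]
    refine lintegral_mono fun r => ?_
    by_cases hr : r.1 (1, k) = true
    · rw [Set.indicator_of_mem (by exact hr)]
      exact (measure_mono fun u hu => hu.1).trans (labelLaw_acceptSet_ne_le l hT r k)
    · rw [Set.indicator_of_notMem (by exact hr)]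
      refine (measure_mono (t := ∅) fun u hu => hr hu.2).trans (by simp)

theorem measure_thin_ne_shift {ρ : ProbabilityMeasure (EqRelSpace Γ)} (hρ : IsIRE ρ)
    {f : EqRelSpace Γ → Γ → ℝ} (hf : ∀ g, Measurable fun r => f r g) (g h : Γ) :
    (ρ.toMeasure.prod (labelLaw Γ)) {p | (thin f p).1 (g, h) ≠ p.1.1 (g, h)} =
    (ρ.toMeasure.prod (labelLaw Γ)) {p | (thin f p).1 (1, g⁻¹ * h) ≠ p.1.1 (1, g⁻¹ * h)} := by
  have hmeas : MeasurableSet {p : EqRelSpace Γ × (Γ → ℝ) |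
      (thin f p).1 (g, h) ≠ p.1.1 (g, h)} := by
    have h1 : Measurable fun p : EqRelSpace Γ × (Γ → ℝ) => (thin f p).1 (g, h) :=
      (measurable_pi_apply (g, h)).comp (measurable_subtype_coe.comp (measurable_thin hf))
    have h2 : Measurable fun p : EqRelSpace Γ × (Γ → ℝ) => p.1.1 (g, h) :=
      (measurable_pi_apply (g, h)).comp (measurable_subtype_coe.comp measurable_fst)
    exact (measurableSet_eq_fun h1 h2).compl
  rw [← (measurePreserving_shift_prod hρ g).measure_preimage hmeas.nullMeasurableSet]
  congr 1
  ext ⟨r, u⟩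
  simp only [Set.mem_preimage, Set.mem_ofPred_eq, Prod.map_apply, thin_shift, shiftE_apply,
    inv_mul_cancel]

theorem IsAIRE.mem_closure_isFIRE {ρ : ProbabilityMeasure (EqRelSpace Γ)} (hρ : IsAIRE ρ) :
    ρ ∈ closure {ρ : ProbabilityMeasure (EqRelSpace Γ) | IsFIRE ρ} := by
  obtain ⟨lam, hl, hlim⟩ := hρ.exists_tendsto_lintegral
  obtain ⟨e, he⟩ := exists_surjective_nat Γ
  have hchoose : ∀ k : ℕ, ∃ n, ∀ i < k, ENNReal.ofReal k *
      ∫⁻ r in {r | r.1 (1, e i) = true}, displacement (lam n) (e i) r ∂ρ.toMeasure ≤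
        (2⁻¹ : ℝ≥0∞) ^ k := by
    intro k
    have h1 : ∀ i < k, ∀ᶠ n in atTop, ENNReal.ofReal k *
      ∫⁻ r in {r | r.1 (1, e i) = true}, displacement (lam n) (e i) r ∂ρ.toMeasure ≤
        (2⁻¹ : ℝ≥0∞) ^ k := by
      intro i _
      have h2 := ENNReal.Tendsto.const_mul (hlim (e i)) (a := ENNReal.ofReal k)
        (Or.inr ENNReal.ofReal_ne_top)
      rw [mul_zero] at h2
      exact h2.eventually_le_const (ENNReal.pow_pos (by simp) k)
    have h3 := (Set.finite_lt_nat k).eventually_all.2 h1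
    exact h3.exists
  choose N hN using hchoose
  have hf : ∀ (k : ℕ) (g : Γ), Measurable fun r => (fun r x => (k : ℝ) * lam (N k) r x) r g :=
    fun k g => ((hl (N k)).measurable g).const_mul _
  refine mem_closure_of_tendsto (f := fun k : ℕ => thinLaw ρ (hf k)) (b := atTop) ?_
    (Eventually.of_forall fun k => ?_)
  · refine tendsto_of_ae_eventually_eq (P := ρ.toMeasure.prod (labelLaw Γ))
      (fun k => measurable_thin (hf k)) measurable_fst (fun k => rfl) (by simp) ?_
    rintro ⟨g, h⟩
    have hbc := ae_eventually_notMem (μ := ρ.toMeasure.prod (labelLaw Γ))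
      (s := fun k : ℕ => {p | (thin (fun r x => (k : ℝ) * lam (N k) r x) p).1 (g, h) ≠
        p.1.1 (g, h)}) ?_
    · filter_upwards [hbc] with p hp
      exact hp.mono fun n hn => not_not.1 hn
    · obtain ⟨i, hi⟩ := he (g⁻¹ * h)
      have hle : ∀ k : ℕ, (ρ.toMeasure.prod (labelLaw Γ))
          {p | (thin (fun r x => (k : ℝ) * lam (N k) r x) p).1 (g, h) ≠ p.1.1 (g, h)} ≤
          (if k ≤ i then 1 else 0) + (ENNReal.ofReal (Real.exp (-(k : ℝ))) + 2⁻¹ ^ k) := by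
        intro k
        split_ifs with hk
        · exact prob_le_one.trans (le_add_right le_rfl)
        · rw [measure_thin_ne_shift hρ.1 (hf k), ← hi, zero_add]
          refine (measure_thin_ne_le (hl (N k)) (Nat.cast_nonneg k) ρ _).trans ?_
          gcongr
          exact hN k i (not_le.1 hk)
      refine ne_top_of_le_ne_top ?_ (ENNReal.tsum_le_tsum hle)
      rw [ENNReal.tsum_add, ENNReal.tsum_add]
      refine ENNReal.add_ne_top.2 ⟨?_, ENNReal.add_ne_top.2 ⟨?_, ?_⟩⟩
      · rw [tsum_eq_sum (s := Finset.range (i + 1))]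
        · exact ENNReal.sum_ne_top.2 fun k _ => by split_ifs <;> simp
        · intro k hk
          rw [if_neg]
          simpa [Nat.lt_succ_iff] using hk
      · rw [← ENNReal.ofReal_tsum_of_nonneg (fun _ => (Real.exp_pos _).le)
          Real.summable_exp_neg_nat]
        exact ENNReal.ofReal_ne_top
      · rw [ENNReal.tsum_geometric]
        simp
  · refine isFIRE_thinLaw hρ.1 (hf k) (T := ENNReal.ofReal (k : ℝ)) ENNReal.ofReal_ne_top
      fun r => ?_
    simp only [ENNReal.ofReal_mul (Nat.cast_nonneg k)]
    rw [ENNReal.tsum_mul_left, tsum_ofReal_eq_one ((hl (N k)).nonneg r) ((hl (N k)).tsum_eq r),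
      mul_one]

end Closure

section ExactToAmenable

theorem isClopen_related (x y : Γ) : IsClopen {r : EqRelSpace Γ | r.1 (x, y) = true} := by
  have h : Continuous fun r : EqRelSpace Γ => r.1 (x, y) :=
    (continuous_apply (x, y)).comp continuous_subtype_val
  exact (isClopen_discrete {true}).preimage h

instance : CompactSpace (EqRelSpace Γ) := by
  refine isCompact_iff_compactSpace.1 (IsClosed.isCompact ?_)
  have hc : ∀ p : Γ × Γ, IsClopen {r : Γ × Γ → Bool | r p = true} := fun p =>
    (isClopen_discrete {true}).preimage (continuous_apply p)
  have h : {r : Γ × Γ → Bool | IsEqRel r} = (⋂ x, {r | r (x, x) = true}) ∩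
      ((⋂ x, ⋂ y, {r | r (x, y) = true}ᶜ ∪ {r | r (y, x) = true}) ∩
      (⋂ x, ⋂ y, ⋂ z, {r | r (x, y) = true}ᶜ ∪
        ({r | r (y, z) = true}ᶜ ∪ {r | r (x, z) = true}))) := by
    ext r
    simp only [IsEqRel, Set.mem_ofPred_eq, Set.mem_inter_iff, Set.mem_iInter, Set.mem_union,
      Set.mem_compl_iff, imp_iff_not_or]
  rw [h]
  refine (isClosed_iInter fun x => (hc _).1).inter
    ((isClosed_iInter fun x => isClosed_iInter fun y => ?_).inter
      (isClosed_iInter fun x => isClosed_iInter fun y => isClosed_iInter fun z => ?_))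
  · exact ((hc _).compl.union (hc _)).1
  · exact ((hc _).compl.union ((hc _).compl.union (hc _))).1

variable [Countable Γ]

theorem isClosed_isIRE : IsClosed {ρ : ProbabilityMeasure (EqRelSpace Γ) | IsIRE ρ} := by
  have h : {ρ : ProbabilityMeasure (EqRelSpace Γ) | IsIRE ρ} =
      ⋂ γ : Γ, {ρ | ρ.map (continuous_shiftE γ).measurable.aemeasurable = ρ} := by
    ext ρ
    simp only [IsIRE, Set.mem_ofPred_eq, Set.mem_iInter]
    refine forall_congr' fun γ => ?_
    rw [← ProbabilityMeasure.toMeasure_injective.eq_iff]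
    rfl
  rw [h]
  exact isClosed_iInter fun γ =>
    isClosed_eq (ProbabilityMeasure.continuous_map (continuous_shiftE γ)) continuous_id

variable {X : Type*} [MeasurableSpace X]

/-- A measure on `E × X` that is invariant under the partial transformations
`(r, x) ↦ (g⁻¹ · r, g⁻¹ · x)` defined on `{(r, x) | g ∈ [1]_r}`. -/
def IsPartiallyInvariant (a : Γ → X → X) (M : Measure (EqRelSpace Γ × X)) : Prop :=
  ∀ g : Γ, (M.restrict {p | p.1.1 (1, g) = true}).map (Prod.map (shiftE g⁻¹) (a g⁻¹)) =
    M.restrict {p | p.1.1 (1, g⁻¹) = true}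

theorem measurableSet_related_fst (x y : Γ) :
    MeasurableSet {p : EqRelSpace Γ × X | p.1.1 (x, y) = true} :=
  measurable_fst (measurableSet_related x y)

theorem isClosed_isPartiallyInvariant [TopologicalSpace X] [PolishSpace X] [BorelSpace X]
    {a : Γ → X → X} (ha : ∀ γ, Continuous (a γ)) :
    IsClosed {M : ProbabilityMeasure (EqRelSpace Γ × X) | IsPartiallyInvariant a M.toMeasure} := by
  have hU : ∀ g : Γ, IsClopen {p : EqRelSpace Γ × X | p.1.1 (1, g) = true} :=
    fun g => (isClopen_related 1 g).preimage continuous_fst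
  have hS : ∀ g : Γ, Continuous (Prod.map (shiftE g) (a g) : EqRelSpace Γ × X → EqRelSpace Γ × X) :=
    fun g => (continuous_shiftE g).prodMap (ha g)
  let F : Γ → BoundedContinuousFunction (EqRelSpace Γ × X) ℝ →
      BoundedContinuousFunction (EqRelSpace Γ × X) ℝ := fun g f =>
    BoundedContinuousFunction.ofNormedAddCommGroup
      ({p : EqRelSpace Γ × X | p.1.1 (1, g) = true}.indicator f)
      (f.continuous.indicator (by simp [(hU g).frontier_eq])) ‖f‖
      (fun p => (norm_indicator_le_norm_self _ _).trans (f.norm_coe_le_norm p))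
  have h : {M : ProbabilityMeasure (EqRelSpace Γ × X) | IsPartiallyInvariant a M.toMeasure} =
      ⋂ g : Γ, ⋂ f : BoundedContinuousFunction (EqRelSpace Γ × X) ℝ,
        {M | ∫ p, F g (f.compContinuous ⟨_, hS g⁻¹⟩) p ∂M.toMeasure =
          ∫ p, F g⁻¹ f p ∂M.toMeasure} := by
    ext M
    simp only [Set.mem_ofPred_eq, Set.mem_iInter]
    refine forall_congr' fun g => ?_
    have e1 : ∀ f : BoundedContinuousFunction (EqRelSpace Γ × X) ℝ,
        ∫ p, F g (f.compContinuous ⟨_, hS g⁻¹⟩) p ∂M.toMeasure =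
        ∫ p, f p ∂((M.toMeasure.restrict {p | p.1.1 (1, g) = true}).map
          (Prod.map (shiftE g⁻¹) (a g⁻¹))) := fun f => by
      rw [integral_map (hS g⁻¹).measurable.aemeasurable f.continuous.aestronglyMeasurable,
        ← integral_indicator (measurableSet_related_fst 1 g)]
      rfl
    have e2 : ∀ f : BoundedContinuousFunction (EqRelSpace Γ × X) ℝ,
        ∫ p, F g⁻¹ f p ∂M.toMeasure =
        ∫ p, f p ∂(M.toMeasure.restrict {p | p.1.1 (1, g⁻¹) = true}) := fun f => by
      rw [← integral_indicator (measurableSet_related_fst 1 g⁻¹)]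
      rfl
    constructor
    · intro hg f
      rw [e1, e2, hg]
    · intro hf
      refine ext_of_forall_integral_eq_of_IsFiniteMeasure fun f => ?_
      rw [← e1, ← e2, hf]
  rw [h]
  have hcont : ∀ f : BoundedContinuousFunction (EqRelSpace Γ × X) ℝ,
      Continuous fun M : ProbabilityMeasure (EqRelSpace Γ × X) => ∫ p, f p ∂M.toMeasure :=
    fun f => continuous_iff_continuousAt.2 fun M =>
      ProbabilityMeasure.tendsto_iff_forall_integral_tendsto.1 tendsto_id f
  exact isClosed_iInter fun g => isClosed_iInter fun f => isClosed_eq (hcont _) (hcont _)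

/-- The number of elements of the class of the identity. -/
noncomputable def classCard (r : EqRelSpace Γ) : ℝ≥0∞ :=
  ∑' d, if r.1 (1, d) = true then 1 else 0

/-- The uniform distribution on the class of the identity. -/
noncomputable def classWeight (c : Γ) (r : EqRelSpace Γ) : ℝ≥0∞ :=
  if r.1 (1, c) = true then (classCard r)⁻¹ else 0

theorem measurable_classCard : Measurable (classCard : EqRelSpace Γ → ℝ≥0∞) :=
  Measurable.tsum fun d => Measurable.ite (measurableSet_related 1 d) measurable_const
    measurable_const

theorem measurable_classWeight (c : Γ) : Measurable (classWeight c) :=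
  Measurable.ite (measurableSet_related 1 c) measurable_classCard.inv measurable_const

theorem related_iff_of_related {r : EqRelSpace Γ} {x y : Γ} (h : r.1 (x, y) = true) (z : Γ) :
    r.1 (y, z) = true ↔ r.1 (x, z) = true :=
  ⟨fun h' => r.2.2.2 _ _ _ h h', fun h' => r.2.2.2 _ _ _ (r.2.2.1 _ _ h) h'⟩

theorem classCard_shiftE {r : EqRelSpace Γ} {g : Γ} (h : r.1 (1, g) = true) :
    classCard (shiftE g⁻¹ r) = classCard r := by
  refine Eq.trans (tsum_congr fun d => ?_)
    ((Equiv.mulLeft g).tsum_eq fun d => if r.1 (1, d) = true then 1 else 0)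
  simp only [shiftE_apply, inv_inv, mul_one, Equiv.coe_mulLeft]
  exact if_congr (related_iff_of_related h _) rfl rfl

theorem classWeight_shiftE {r : EqRelSpace Γ} {g : Γ} (h : r.1 (1, g) = true) (c : Γ) :
    classWeight (g⁻¹ * c) (shiftE g⁻¹ r) = classWeight c r := by
  simp only [classWeight, classCard_shiftE h, shiftE_apply, inv_inv, mul_one, mul_inv_cancel_left,
    related_iff_of_related h]

theorem tsum_classWeight {r : EqRelSpace Γ} (h : (classOf r 1).Finite) :
    ∑' c, classWeight c r = 1 := by
  have h1 : ∀ c, classWeight c r = (if r.1 (1, c) = true then 1 else 0) * (classCard r)⁻¹ := by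
    intro c
    simp [classWeight]
  simp only [h1]
  rw [ENNReal.tsum_mul_right]
  refine ENNReal.mul_inv_cancel ?_ ?_
  · intro h0
    have := ENNReal.tsum_eq_zero.1 h0 1
    simp [r.2.1 1] at this
  · change ∑' d, _ ≠ _
    rw [tsum_eq_sum (s := h.toFinset)]
    · exact ENNReal.sum_ne_top.2 fun k _ => by split_ifs <;> simp
    · intro d hd
      rw [if_neg]
      simpa [classOf] using hd

theorem IsFIRE.exists_partiallyInvariant {ρ : ProbabilityMeasure (EqRelSpace Γ)} (hρ : IsFIRE ρ)
    {a : Γ → X → X} (ha : ∀ γ, Measurable (a γ)) (hmul : ∀ γ δ x, a (γ * δ) x = a γ (a δ x))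
    (x₀ : X) :
    ∃ M : ProbabilityMeasure (EqRelSpace Γ × X), IsPartiallyInvariant a M.toMeasure ∧
      M.toMeasure.map Prod.fst = ρ.toMeasure := by
  have hpair : ∀ c : Γ, Measurable fun r : EqRelSpace Γ => (r, a c x₀) :=
    fun c => measurable_id.prodMk measurable_const
  set M : Measure (EqRelSpace Γ × X) := Measure.sum fun c : Γ =>
    (ρ.toMeasure.withDensity (classWeight c)).map fun r => (r, a c x₀) with hM
  have hinteg : ∀ F : EqRelSpace Γ × X → ℝ≥0∞, Measurable F →
      ∫⁻ p, F p ∂M = ∑' c, ∫⁻ r, classWeight c r * F (r, a c x₀) ∂ρ.toMeasure := by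
    intro F hF
    rw [hM, lintegral_sum_measure]
    refine tsum_congr fun c => ?_
    rw [lintegral_map hF (hpair c), lintegral_withDensity_eq_lintegral_mul _
      (measurable_classWeight c) (g := fun r => F (r, a c x₀)) (hF.comp (hpair c))]
    rfl
  have hfst : M.map Prod.fst = ρ.toMeasure := by
    refine Measure.ext_of_lintegral _ fun f hf => ?_
    rw [lintegral_map hf measurable_fst, hinteg (fun p => f p.1) (hf.comp measurable_fst),
      ← lintegral_tsum (f := fun c r => classWeight c r * f r)
        fun c => ((measurable_classWeight c).mul hf).aemeasurable]
    refine lintegral_congr_ae ?_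
    filter_upwards [hρ.2] with r hr
    simp only [ENNReal.tsum_mul_right, tsum_classWeight (hr 1), one_mul]
  have hprob : IsProbabilityMeasure M := by
    constructor
    rw [← Set.preimage_univ (f := Prod.fst), ← Measure.map_apply measurable_fst MeasurableSet.univ,
      hfst, measure_univ]
  refine ⟨⟨M, hprob⟩, fun g => ?_, hfst⟩
  have hS : Measurable (Prod.map (shiftE g⁻¹) (a g⁻¹) : EqRelSpace Γ × X → EqRelSpace Γ × X) :=
    (measurable_shiftE g⁻¹).prodMap (ha g⁻¹)
  refine Measure.ext_of_lintegral _ fun F hF => ?_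
  rw [lintegral_map hF hS]
  change ∫⁻ p in _, _ ∂M = ∫⁻ p in _, _ ∂M
  rw [← lintegral_indicator (measurableSet_related_fst 1 g),
    ← lintegral_indicator (measurableSet_related_fst 1 g⁻¹),
    hinteg _ (Measurable.indicator (f := fun p => F (Prod.map (shiftE g⁻¹) (a g⁻¹) p)) (hF.comp hS)
      (measurableSet_related_fst 1 g)),
    hinteg _ (hF.indicator (measurableSet_related_fst 1 g⁻¹))]
  refine (tsum_congr fun c => ?_).trans ((Equiv.mulLeft g⁻¹).tsum_eq fun c =>
    ∫⁻ r, classWeight c r * {p | p.1.1 (1, g⁻¹) = true}.indicator F (r, a c x₀) ∂ρ.toMeasure)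
  refine Eq.trans (lintegral_congr fun r => ?_)
    ((hρ.1.measurePreserving g⁻¹).lintegral_comp ((measurable_classWeight _).mul
      ((hF.indicator (measurableSet_related_fst 1 g⁻¹)).comp (hpair _))))
  by_cases h : r.1 (1, g) = true
  · rw [Set.indicator_of_mem (by exact h), Set.indicator_of_mem]
    · simp only [Equiv.coe_mulLeft, classWeight_shiftE h, Prod.map_apply, hmul]
    · simpa [shiftE_apply] using r.2.2.1 _ _ h
  · rw [Set.indicator_of_notMem (by exact h), Set.indicator_of_notMem]
    · simp
    · intro h'
      apply h
      simp only [Set.mem_ofPred_eq, shiftE_apply, inv_inv, mul_one, mul_inv_cancel] at h'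
      exact r.2.2.1 _ _ h'

theorem exists_partiallyInvariant_of_mem_closure [TopologicalSpace X] [PolishSpace X]
    [CompactSpace X] [BorelSpace X] {a : Γ → X → X} (ha : ∀ γ, Continuous (a γ))
    (hmul : ∀ γ δ x, a (γ * δ) x = a γ (a δ x)) (x₀ : X) {ρ : ProbabilityMeasure (EqRelSpace Γ)}
    (hρ : ρ ∈ closure {ρ : ProbabilityMeasure (EqRelSpace Γ) | IsFIRE ρ}) :
    ∃ M : ProbabilityMeasure (EqRelSpace Γ × X), IsPartiallyInvariant a M.toMeasure ∧
      M.toMeasure.map Prod.fst = ρ.toMeasure := by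
  have hcl : IsClosed ((fun M : ProbabilityMeasure (EqRelSpace Γ × X) =>
      M.map continuous_fst.measurable.aemeasurable) ''
      {M | IsPartiallyInvariant a M.toMeasure}) :=
    ((isClosed_isPartiallyInvariant ha).isCompact.image
      (ProbabilityMeasure.continuous_map continuous_fst)).isClosed
  have hsub : {ρ : ProbabilityMeasure (EqRelSpace Γ) | IsFIRE ρ} ⊆
      (fun M : ProbabilityMeasure (EqRelSpace Γ × X) =>
        M.map continuous_fst.measurable.aemeasurable) ''
        {M | IsPartiallyInvariant a M.toMeasure} := by
    intro ρ' hρ'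
    obtain ⟨M, hM, hfst⟩ := hρ'.exists_partiallyInvariant (fun γ => (ha γ).measurable) hmul x₀
    exact ⟨M, hM, Subtype.ext hfst⟩
  obtain ⟨M, hM, hfst⟩ := closure_minimal hsub hcl hρ
  exact ⟨M, hM, congrArg ProbabilityMeasure.toMeasure hfst⟩

end ExactToAmenable

section Disintegration

theorem tsum_eq_one_of_tsum_ofReal {α : Type*} {a : α → ℝ} (h0 : ∀ x, 0 ≤ a x)
    (h : ∑' x, ENNReal.ofReal (a x) = 1) : ∑' x, a x = 1 := by
  have h1 := congrArg ENNReal.toReal h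
  rw [ENNReal.tsum_toReal_eq fun _ => ENNReal.ofReal_ne_top, ENNReal.toReal_one] at h1
  simpa only [ENNReal.toReal_ofReal (h0 _)] using h1

variable [Countable Γ] {X : Type*} [MeasurableSpace X]

theorem IsPartiallyInvariant.ae_lintegral_condKernel_eq [StandardBorelSpace X] [Nonempty X]
    {a : Γ → X → X} (ha : ∀ γ, Measurable (a γ)) {M : Measure (EqRelSpace Γ × X)}
    [IsProbabilityMeasure M] (hM : IsPartiallyInvariant a M)
    {ρ : ProbabilityMeasure (EqRelSpace Γ)} (hρ : IsIRE ρ) (hfst : M.map Prod.fst = ρ.toMeasure)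
    {f : X → ℝ≥0∞} (hf : Measurable f) (g : Γ) :
    ∀ᵐ r ∂ρ.toMeasure, r.1 (1, g) = true →
      ∫⁻ x, f x ∂M.condKernel (shiftE g⁻¹ r) = ∫⁻ x, f (a g⁻¹ x) ∂M.condKernel r := by
  have hdis : ∀ F : EqRelSpace Γ × X → ℝ≥0∞, Measurable F →
      ∫⁻ p, F p ∂M = ∫⁻ r, ∫⁻ x, F (r, x) ∂M.condKernel r ∂ρ.toMeasure := by
    intro F hF
    conv_lhs => rw [← M.disintegrate M.condKernel]
    rw [Measure.lintegral_compProd hF, Measure.fst, hfst]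
  have hL : ∀ {k : X → ℝ≥0∞}, Measurable k → Measurable fun r => ∫⁻ x, k x ∂M.condKernel r :=
    fun hk => hk.lintegral_kernel
  refine (ae_restrict_iff' (measurableSet_related 1 g)).1 ?_
  refine ae_eq_of_forall_setLIntegral_eq_of_sigmaFinite
    ((hL hf).comp (measurable_shiftE g⁻¹)) (hL (hf.comp (ha g⁻¹))) fun A hA _ => ?_
  rw [Measure.restrict_restrict hA]
  have hV := measurableSet_related (Γ := Γ) 1 g
  set B : Set (EqRelSpace Γ) := shiftE g ⁻¹' A with hB
  have hBm : MeasurableSet B := measurable_shiftE g hA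
  have hV' := measurableSet_related (Γ := Γ) 1 g⁻¹
  have hpre : A ∩ {r | r.1 (1, g) = true} =
      shiftE g⁻¹ ⁻¹' (B ∩ {r | r.1 (1, g⁻¹) = true}) := by
    ext r
    simp only [hB, Set.mem_inter_iff, Set.mem_preimage, Set.mem_ofPred_eq, ← shiftE_mul,
      mul_inv_cancel, shiftE_one, shiftE_apply, inv_inv, mul_one]
    exact and_congr_right fun _ => ⟨r.2.2.1 _ _, r.2.2.1 _ _⟩
  have hS : Measurable (Prod.map (shiftE g⁻¹) (a g⁻¹) : EqRelSpace Γ × X → EqRelSpace Γ × X) :=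
    (measurable_shiftE g⁻¹).prodMap (ha g⁻¹)
  have hlift : ∀ {k : X → ℝ≥0∞} {C : Set (EqRelSpace Γ)}, Measurable k → MeasurableSet C →
      ∫⁻ r in C, ∫⁻ x, k x ∂M.condKernel r ∂ρ.toMeasure =
        ∫⁻ p in Prod.fst ⁻¹' C, k p.2 ∂M := by
    intro k C hk hC
    rw [← lintegral_indicator (measurable_fst hC),
      hdis _ (Measurable.indicator (f := fun p => k p.2) (by fun_prop)
        (measurable_fst hC)), ← lintegral_indicator hC]
    refine lintegral_congr fun r => ?_
    by_cases hr : r ∈ C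
    · rw [Set.indicator_of_mem hr]
      exact lintegral_congr fun x => (Set.indicator_of_mem (s := Prod.fst ⁻¹' C)
        (a := (r, x)) hr fun p => k p.2).symm
    · rw [Set.indicator_of_notMem hr]
      refine Eq.trans (by simp) (lintegral_congr fun x =>
        (Set.indicator_of_notMem (by exact hr) _).symm)
  calc ∫⁻ r in A ∩ {r | r.1 (1, g) = true}, ∫⁻ x, f x ∂M.condKernel (shiftE g⁻¹ r) ∂ρ.toMeasure
      = ∫⁻ r in B ∩ {r | r.1 (1, g⁻¹) = true}, ∫⁻ x, f x ∂M.condKernel r ∂ρ.toMeasure := by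
        rw [hpre]
        exact (hρ.measurePreserving g⁻¹).setLIntegral_comp_preimage (hBm.inter hV') (hL hf)
    _ = ∫⁻ p in Prod.fst ⁻¹' B, f p.2 ∂(M.restrict {p | p.1.1 (1, g⁻¹) = true}) := by
        rw [hlift hf (hBm.inter hV'), Measure.restrict_restrict (measurable_fst hBm)]
        rfl
    _ = ∫⁻ p in Prod.map (shiftE g⁻¹) (a g⁻¹) ⁻¹' (Prod.fst ⁻¹' B), f (a g⁻¹ p.2)
          ∂(M.restrict {p | p.1.1 (1, g) = true}) := by
        rw [← hM g, setLIntegral_map (f := fun p => f p.2) (measurable_fst hBm) (by fun_prop) hS]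
        rfl
    _ = ∫⁻ r in A ∩ {r | r.1 (1, g) = true}, ∫⁻ x, f (a g⁻¹ x) ∂M.condKernel r ∂ρ.toMeasure := by
        rw [hlift (k := fun x => f (a g⁻¹ x)) (hf.comp (ha g⁻¹)) (hA.inter hV),
          Measure.restrict_restrict (hS (measurable_fst hBm))]
        congr 2
        ext p
        simp only [hB, Set.mem_inter_iff, Set.mem_preimage, ← shiftE_mul,
          mul_inv_cancel, shiftE_one, Set.mem_ofPred_eq, Prod.map_fst]

theorem IsPartiallyInvariant.isAIRE [TopologicalSpace X] [PolishSpace X] [BorelSpace X]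
    [Nonempty X] {a : Γ → X → X} (ha : ∀ γ, Continuous (a γ)) (hamen : TopAmenableAction Γ a)
    {M : ProbabilityMeasure (EqRelSpace Γ × X)} (hM : IsPartiallyInvariant a M.toMeasure)
    {ρ : ProbabilityMeasure (EqRelSpace Γ)} (hρ : IsIRE ρ)
    (hfst : M.toMeasure.map Prod.fst = ρ.toMeasure) : IsAIRE ρ := by
  obtain ⟨η, h0, h1, hc, hη⟩ := hamen
  set κ := M.toMeasure.condKernel with hκ
  have hle : ∀ n x g, η n x g ≤ 1 := fun n x g =>
    (h1 n x) ▸ (summable_of_tsum_eq_one (h1 n x)).le_tsum g fun _ _ => h0 _ _ _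
  have hofReal : ∀ n r g, ENNReal.ofReal (∫ x, η n x g ∂κ r) =
      ∫⁻ x, ENNReal.ofReal (η n x g) ∂κ r := fun n r g =>
    ofReal_integral_eq_lintegral_ofReal (Integrable.of_bound
      (hc n g).measurable.aestronglyMeasurable 1 (ae_of_all _ fun x => by
        rw [Real.norm_of_nonneg (h0 n x g)]
        exact hle n x g)) (ae_of_all _ fun x => h0 n x g)
  have hnn : ∀ n r g, 0 ≤ ∫ x, η n x g ∂κ r := fun n r g => integral_nonneg fun x => h0 n x g
  refine ⟨hρ, fun n r g => ∫ x, η n x g ∂κ r, fun n g => ?_, hnn, fun n r => ?_, ?_⟩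
  · have : (fun r => ∫ x, η n x g ∂κ r) =
        fun r => (∫⁻ x, ENNReal.ofReal (η n x g) ∂κ r).toReal := by
      funext r
      rw [← hofReal, ENNReal.toReal_ofReal (hnn n r g)]
    rw [this]
    exact (hc n g).measurable.ennreal_ofReal.lintegral_kernel.ennreal_toReal
  · refine tsum_eq_one_of_tsum_ofReal (hnn n r) ?_
    simp only [hofReal]
    rw [← lintegral_tsum fun g => (hc n g).measurable.ennreal_ofReal.aemeasurable]
    simp [tsum_ofReal_eq_one (h0 n _) (h1 n _)]
  · have hae : ∀ᵐ r ∂ρ.toMeasure, ∀ g n h, r.1 (1, g) = true →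
        ∫⁻ x, ENNReal.ofReal (η n x h) ∂κ (shiftE g⁻¹ r) =
          ∫⁻ x, ENNReal.ofReal (η n (a g⁻¹ x) h) ∂κ r :=
      ae_all_iff.2 fun g => ae_all_iff.2 fun n => ae_all_iff.2 fun h =>
        hM.ae_lintegral_condKernel_eq (fun γ => (ha γ).measurable) hρ hfst
          (hc n h).measurable.ennreal_ofReal g
    filter_upwards [hae] with r hr g hg
    have hshift : ∀ n h, ∫ x, η n x h ∂κ (shiftE g⁻¹ r) = ∫ x, η n (a g⁻¹ x) h ∂κ r := by
      intro n h
      rw [integral_eq_lintegral_of_nonneg_ae (ae_of_all _ fun x => h0 n x h)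
        (hc n h).measurable.aestronglyMeasurable, hr g n h hg,
        integral_eq_lintegral_of_nonneg_ae (ae_of_all _ fun x => h0 n _ h)
        ((hc n h).comp (ha g⁻¹)).measurable.aestronglyMeasurable]
    have hinteg : ∀ n h (b : X → X), Continuous b → Integrable (fun x => η n (b x) h) (κ r) :=
      fun n h b hb => Integrable.of_bound ((hc n h).comp hb).measurable.aestronglyMeasurable 1
        (ae_of_all _ fun x => by
          rw [Real.norm_of_nonneg (h0 n _ h)]
          exact hle n _ h)
    rw [Metric.tendsto_atTop]
    intro ε hε
    obtain ⟨N, hN⟩ := hη g⁻¹ (ε / 2) (half_pos hε)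
    refine ⟨N, fun n hn => ?_⟩
    have hbound : ∑' h, ENNReal.ofReal
        |∫ x, η n x (g * h) ∂κ r - ∫ x, η n x h ∂κ (shiftE g⁻¹ r)| ≤ ENNReal.ofReal (ε / 2) := by
      calc _ ≤ ∑' h, ∫⁻ x, ENNReal.ofReal |η n x (g * h) - η n (a g⁻¹ x) h| ∂κ r := by
            refine ENNReal.tsum_le_tsum fun h => ?_
            rw [hshift, ← integral_sub (f := fun x => η n x (g * h))
              (hinteg n (g * h) id continuous_id)
              (hinteg n h (a g⁻¹) (ha g⁻¹)), ← Real.enorm_eq_ofReal_abs]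
            refine (enorm_integral_le_lintegral_enorm _).trans (le_of_eq ?_)
            simp only [Real.enorm_eq_ofReal_abs]
        _ = ∫⁻ x, ∑' h, ENNReal.ofReal |η n x (g * h) - η n (a g⁻¹ x) h| ∂κ r := by
            rw [lintegral_tsum fun h => ?_]
            exact (continuous_abs.comp ((hc n (g * h)).sub
              ((hc n h).comp (ha g⁻¹)))).measurable.ennreal_ofReal.aemeasurable
        _ ≤ ∫⁻ _, ENNReal.ofReal (ε / 2) ∂κ r := by
            refine lintegral_mono fun x => ?_
            rw [← ENNReal.ofReal_tsum_of_nonneg (fun _ => abs_nonneg _)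
              (summable_abs_sub (tsum_mul_left_eq g (h1 n x)) (h1 n _))]
            refine ENNReal.ofReal_le_ofReal ?_
            have := hN n hn x
            rw [inv_inv] at this
            exact this.le
        _ = _ := by simp
    have h2 := ENNReal.toReal_mono ENNReal.ofReal_ne_top hbound
    rw [ENNReal.tsum_toReal_eq fun _ => ENNReal.ofReal_ne_top,
      ENNReal.toReal_ofReal (half_pos hε).le] at h2
    simp only [ENNReal.toReal_ofReal (abs_nonneg _)] at h2
    rw [Real.dist_eq, sub_zero, abs_of_nonneg (tsum_nonneg fun _ => abs_nonneg _)]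
    linarith

theorem IsExactGroup.closure_isFIRE_subset (hΓ : IsExactGroup Γ) :
    closure {ρ : ProbabilityMeasure (EqRelSpace Γ) | IsFIRE ρ} ⊆ {ρ | IsAIRE ρ} := by
  obtain ⟨X, _, a, _, _, _, _, hmul, ha, hamen⟩ := hΓ
  let := TopologicalSpace.metrizableSpaceMetric X
  let : MeasurableSpace X := borel X
  have : BorelSpace X := ⟨rfl⟩
  have : PolishSpace X := inferInstance
  obtain ⟨x₀⟩ := ‹Nonempty X›
  intro ρ hρ
  have hinv : IsIRE ρ := closure_minimal (fun ρ hρ => hρ.1) isClosed_isIRE hρ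
  obtain ⟨M, hM, hfst⟩ := exists_partiallyInvariant_of_mem_closure ha hmul x₀ hρ
  have : Nonempty X := ⟨x₀⟩
  exact hM.isAIRE ha hamen hinv hfst

end Disintegration

section UniformFields

variable [Countable Γ]

/-- Turn a nonnegative vector with support in `K` into a probability vector: missing mass is put
at the identity, excess mass is removed by rescaling. -/
noncomputable def normalizeVec (K : Finset Γ) (v : Γ → ℝ) (x : Γ) : ℝ := by
  classical exact (v x + if x = 1 then max (1 - ∑ y ∈ K, v y) 0 else 0) / max (∑ y ∈ K, v y) 1

theorem normalizeVec_nonneg {K : Finset Γ} {v : Γ → ℝ} (h0 : ∀ x, 0 ≤ v x) (x : Γ) :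
    0 ≤ normalizeVec K v x := by
  have h1 : (0 : ℝ) < max (∑ y ∈ K, v y) 1 := lt_max_of_lt_right one_pos
  have h2 : (0 : ℝ) ≤ max (1 - ∑ y ∈ K, v y) 0 := le_max_right _ _
  unfold normalizeVec
  split_ifs
  · exact div_nonneg (add_nonneg (h0 x) h2) h1.le
  · exact div_nonneg (add_nonneg (h0 x) le_rfl) h1.le

theorem normalizeVec_eq_zero {K : Finset Γ} {v : Γ → ℝ} (hK : 1 ∈ K) (hv : ∀ x ∉ K, v x = 0)
    {x : Γ} (hx : x ∉ K) : normalizeVec K v x = 0 := by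
  have : x ≠ 1 := fun h => hx (h ▸ hK)
  simp [normalizeVec, this, hv x hx]

theorem tsum_normalizeVec {K : Finset Γ} {v : Γ → ℝ} (hK : 1 ∈ K) (hv : ∀ x ∉ K, v x = 0) :
    ∑' x, normalizeVec K v x = 1 := by
  classical
  rw [tsum_eq_sum (s := K) fun x hx => normalizeVec_eq_zero hK hv hx]
  simp only [normalizeVec]
  rw [← Finset.sum_div, Finset.sum_add_distrib, Finset.sum_ite_eq' K 1, if_pos hK]
  rw [div_eq_one_iff_eq (lt_max_of_lt_right one_pos).ne']
  rcases le_total (∑ y ∈ K, v y) 1 with h | h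
  · rw [max_eq_left (by linarith), max_eq_right h]
    ring
  · rw [max_eq_right (by linarith), max_eq_left h]
    ring

theorem sum_abs_normalizeVec_sub {K : Finset Γ} {v : Γ → ℝ} (hK : 1 ∈ K) (h0 : ∀ x, 0 ≤ v x) :
    ∑ x ∈ K, |normalizeVec K v x - v x| = |∑ x ∈ K, v x - 1| := by
  classical
  rcases le_total (∑ y ∈ K, v y) 1 with h | h
  · have h1 : ∀ x ∈ K, |normalizeVec K v x - v x| =
        if x = 1 then 1 - ∑ y ∈ K, v y else 0 := by
      intro x _
      simp only [normalizeVec]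
      rw [max_eq_right h, max_eq_left (by linarith), div_one, add_sub_cancel_left]
      split_ifs
      · exact abs_of_nonneg (by linarith)
      · exact abs_zero
    rw [Finset.sum_congr rfl h1, Finset.sum_ite_eq' K 1, if_pos hK, abs_of_nonpos (by linarith)]
    ring
  · have hpos : 0 < ∑ y ∈ K, v y := by linarith
    have h1 : ∀ x ∈ K, |normalizeVec K v x - v x| = v x * (1 - (∑ y ∈ K, v y)⁻¹) := by
      intro x _
      simp only [normalizeVec]
      rw [max_eq_left h, max_eq_right (by linarith), ite_self, add_zero, abs_sub_comm,
        div_eq_mul_inv, ← mul_one_sub]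
      exact abs_of_nonneg (mul_nonneg (h0 x) (sub_nonneg.2 (inv_le_one_of_one_le₀ h)))
    rw [Finset.sum_congr rfl h1, ← Finset.sum_mul, abs_of_nonneg (by linarith), mul_one_sub,
      mul_inv_cancel₀ hpos.ne']

theorem tsum_abs_normalizeVec_sub_le {K : Finset Γ} {v b : Γ → ℝ} (hK : 1 ∈ K)
    (h0 : ∀ x, 0 ≤ v x) (hv : ∀ x ∉ K, v x = 0) (hb : ∑' x, b x = 1) :
    ∑' x, ENNReal.ofReal |normalizeVec K v x - b x| ≤
      2 * ∑' x, ENNReal.ofReal |v x - b x| := by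
  have hvs : Summable v := summable_of_ne_finset_zero (s := K) hv
  have hS : ∑' x, v x = ∑ x ∈ K, v x := tsum_eq_sum hv
  have hsum := hvs.sub (summable_of_tsum_eq_one hb)
  have h1 : ENNReal.ofReal |∑ x ∈ K, v x - 1| ≤ ∑' x, ENNReal.ofReal |v x - b x| := by
    rw [← ENNReal.ofReal_tsum_of_nonneg (fun _ => abs_nonneg _) hsum.abs, ← hS, ← hb,
      ← hvs.tsum_sub (summable_of_tsum_eq_one hb)]
    refine ENNReal.ofReal_le_ofReal ?_
    have hnorm : Summable fun x => ‖v x - b x‖ := hsum.norm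
    simpa only [Real.norm_eq_abs] using norm_tsum_le_tsum_norm hnorm
  have h2 : ∑' x, ENNReal.ofReal |normalizeVec K v x - v x| =
      ENNReal.ofReal |∑ x ∈ K, v x - 1| := by
    rw [tsum_eq_sum (s := K), ← ENNReal.ofReal_sum_of_nonneg fun _ _ => abs_nonneg _,
      sum_abs_normalizeVec_sub hK h0]
    intro x hx
    simp [normalizeVec_eq_zero hK hv hx, hv x hx]
  calc _ ≤ ∑' x, (ENNReal.ofReal |normalizeVec K v x - v x| + ENNReal.ofReal |v x - b x|) := by
        refine ENNReal.tsum_le_tsum fun x => ?_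
        rw [← ENNReal.ofReal_add (abs_nonneg _) (abs_nonneg _)]
        exact ENNReal.ofReal_le_ofReal (abs_sub_le _ _ _)
    _ ≤ _ := by
        rw [ENNReal.tsum_add, h2, two_mul]
        gcongr

theorem continuous_normalizeVec {Y : Type*} [TopologicalSpace Y] {K : Finset Γ} {v : Y → Γ → ℝ}
    (hv : ∀ x, Continuous fun y => v y x) (x : Γ) : Continuous fun y => normalizeVec K (v y) x := by
  classical
  simp only [normalizeVec]
  have hs : Continuous fun y => ∑ z ∈ K, v y z := continuous_finsetSum _ fun z _ => hv z
  refine Continuous.div ?_ (hs.max continuous_const)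
    fun y => (lt_max_of_lt_right one_pos).ne'
  split_ifs
  · exact (hv x).add ((continuous_const.sub hs).max continuous_const)
  · exact (hv x).add continuous_const

theorem IsProbField.exists_continuous_approx {l : EqRelSpace Γ → Γ → ℝ} (hl : IsProbField l)
    (ρ : ProbabilityMeasure (EqRelSpace Γ)) {δ : ℝ≥0∞} (hδ : 0 < δ) :
    ∃ (K : Finset Γ) (l' : EqRelSpace Γ → Γ → ℝ), IsProbField l' ∧
      (∀ g, Continuous fun r => l' r g) ∧
      (∀ r, ∀ g ∉ K, l' r g = 0) ∧
      ∫⁻ r, ∑' x, ENNReal.ofReal |l' r x - l r x| ∂ρ.toMeasure ≤ 4 * δ := by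
  classical
  obtain ⟨d, hd0, hd⟩ := ENNReal.exists_pos_sum_of_countable' hδ.ne' Γ
  have hle1 : ∀ r g, l r g ≤ 1 := fun r g =>
    (hl.tsum_eq r) ▸ (summable_of_tsum_eq_one (hl.tsum_eq r)).le_tsum g fun _ _ => hl.nonneg _ _
  have hinteg : ∀ g, Integrable (fun r => l r g) ρ.toMeasure := fun g =>
    Integrable.of_bound (hl.measurable g).aestronglyMeasurable 1 (ae_of_all _ fun r => by
      rw [Real.norm_of_nonneg (hl.nonneg r g)]
      exact hle1 r g)
  choose f hf _ using fun g => (hinteg g).exists_boundedContinuous_lintegral_sub_le (hd0 g).ne'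
  have htot : ∑' g, ∫⁻ r, ENNReal.ofReal (l r g) ∂ρ.toMeasure = 1 := by
    rw [← lintegral_tsum fun g => (hl.measurable g).ennreal_ofReal.aemeasurable]
    simp [tsum_ofReal_eq_one (hl.nonneg _) (hl.tsum_eq _)]
  have htail := ENNReal.tendsto_tsum_compl_atTop_zero (htot ▸ ENNReal.one_ne_top)
  obtain ⟨K, hKδ, hK1⟩ := ((htail.eventually_le_const hδ).and (eventually_ge_atTop {1})).exists
  have hK : (1 : Γ) ∈ K := hK1 (Finset.mem_singleton_self 1)
  let v : EqRelSpace Γ → Γ → ℝ := fun r x => if x ∈ K then max (f x r) 0 else 0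
  have hv0 : ∀ r x, 0 ≤ v r x := fun r x => by
    simp only [v]
    split_ifs
    · exact le_max_right _ _
    · exact le_rfl
  have hvK : ∀ r, ∀ x ∉ K, v r x = 0 := fun r x hx => if_neg hx
  have hvc : ∀ x, Continuous fun r => v r x := fun x => by
    simp only [v]
    split_ifs
    · exact (f x).continuous.max continuous_const
    · exact continuous_const
  have hlc : ∀ g, Continuous fun r => normalizeVec K (v r) g := continuous_normalizeVec hvc
  refine ⟨K, fun r => normalizeVec K (v r), ⟨fun g => (hlc g).measurable,
    fun r => normalizeVec_nonneg (hv0 r), fun r => tsum_normalizeVec hK (hvK r)⟩, hlc,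
    fun r g hg => normalizeVec_eq_zero hK (hvK r) hg, ?_⟩
  have hvm : ∀ x, Measurable fun r => ENNReal.ofReal |v r x - l r x| := fun x =>
    (continuous_abs.measurable.comp ((hvc x).measurable.sub (hl.measurable x))).ennreal_ofReal
  calc _ ≤ ∫⁻ r, 2 * ∑' x, ENNReal.ofReal |v r x - l r x| ∂ρ.toMeasure :=
        lintegral_mono fun r => tsum_abs_normalizeVec_sub_le hK (hv0 r) (hvK r) (hl.tsum_eq r)
    _ = 2 * ∑' x, ∫⁻ r, ENNReal.ofReal |v r x - l r x| ∂ρ.toMeasure := by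
        rw [lintegral_const_mul _ (Measurable.tsum hvm),
          lintegral_tsum fun x => (hvm x).aemeasurable]
    _ ≤ 2 * ∑' x, (d x + ({x | x ∉ K} : Set Γ).indicator
          (fun x => ∫⁻ r, ENNReal.ofReal (l r x) ∂ρ.toMeasure) x) := by
        gcongr with x
        by_cases hx : x ∈ K
        · rw [Set.indicator_of_notMem (by simpa using hx), add_zero]
          refine le_trans (lintegral_mono fun r => ?_) (hf x)
          rw [← ofReal_norm, Real.norm_eq_abs]
          refine ENNReal.ofReal_le_ofReal ?_
          simp only [v, if_pos hx]
          rw [← max_eq_left (hl.nonneg r x), abs_sub_comm (l r x ⊔ 0)]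
          refine (abs_max_sub_max_le_abs _ _ _).trans (le_of_eq ?_)
          rw [max_eq_left (hl.nonneg r x)]
        · rw [Set.indicator_of_mem (by simpa using hx)]
          refine le_trans (lintegral_mono fun r => ?_) le_add_self
          simp only [v, if_neg hx, zero_sub, abs_neg, abs_of_nonneg (hl.nonneg r x), le_refl]
    _ ≤ 2 * (δ + δ) := by
        rw [ENNReal.tsum_add, ← tsum_subtype]
        gcongr
        exact hKδ
    _ = 4 * δ := by
        rw [← two_mul, ← mul_assoc]
        norm_num

end UniformFields

section UniformAmenability

variable [Countable Γ]

theorem displacement_le_add (l l' : EqRelSpace Γ → Γ → ℝ) (g : Γ) (r : EqRelSpace Γ) :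
    displacement l' g r ≤ displacement l g r +
      ((∑' x, ENNReal.ofReal |l' r x - l r x|) +
        ∑' x, ENNReal.ofReal |l' (shiftE g⁻¹ r) x - l (shiftE g⁻¹ r) x|) := by
  unfold displacement
  rw [← (Equiv.mulLeft g).tsum_eq fun x => ENNReal.ofReal |l' r x - l r x|,
    ← ENNReal.tsum_add, ← ENNReal.tsum_add]
  refine ENNReal.tsum_le_tsum fun x => ?_
  rw [← ENNReal.ofReal_add (abs_nonneg _) (abs_nonneg _),
    ← ENNReal.ofReal_add (abs_nonneg _) (by positivity)]
  refine ENNReal.ofReal_le_ofReal ?_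
  rw [Equiv.coe_mulLeft]
  set a := l r (g * x)
  set b := l' r (g * x)
  set c := l (shiftE g⁻¹ r) x
  set d := l' (shiftE g⁻¹ r) x
  have h1 : b - d = (a - c) + ((b - a) + (c - d)) := by ring
  rw [h1, abs_sub_comm d c]
  exact (abs_add_le _ _).trans (by gcongr; exact abs_add_le _ _)

theorem IsIRE.lintegral_displacement_le {ρ : ProbabilityMeasure (EqRelSpace Γ)} (hρ : IsIRE ρ)
    {l l' : EqRelSpace Γ → Γ → ℝ} (hl : IsProbField l) (hl' : IsProbField l') (g : Γ) :
    ∫⁻ r in {r | r.1 (1, g) = true}, displacement l' g r ∂ρ.toMeasure ≤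
      ∫⁻ r in {r | r.1 (1, g) = true}, displacement l g r ∂ρ.toMeasure +
        2 * ∫⁻ r, ∑' x, ENNReal.ofReal |l' r x - l r x| ∂ρ.toMeasure := by
  have hD : Measurable fun r => ∑' x, ENNReal.ofReal |l' r x - l r x| :=
    Measurable.tsum fun x => (continuous_abs.measurable.comp
      ((hl'.measurable x).sub (hl.measurable x))).ennreal_ofReal
  have hinv := (hρ.measurePreserving g⁻¹).lintegral_comp hD
  calc _ ≤ _ := lintegral_mono fun r => displacement_le_add l l' g r
    _ = _ := lintegral_add_left (measurable_displacement hl.measurable g) _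
    _ ≤ _ := by
        gcongr
        refine (setLIntegral_le_lintegral _ _).trans (le_of_eq ?_)
        rw [lintegral_add_left hD, hinv, two_mul]

theorem displacement_eq_sum [DecidableEq Γ] {l : EqRelSpace Γ → Γ → ℝ} {K : Finset Γ}
    (hK : ∀ r, ∀ g ∉ K, l r g = 0) (s : Γ) (r : EqRelSpace Γ) :
    displacement l s r = ∑ x ∈ K ∪ K.image (s⁻¹ * ·),
      ENNReal.ofReal |l r (s * x) - l (shiftE s⁻¹ r) x| := by
  refine tsum_eq_sum fun x hx => ?_
  rw [Finset.mem_union, not_or, Finset.mem_image] at hx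
  have h1 : s * x ∉ K := fun h => hx.2 ⟨s * x, h, by simp⟩
  simp [hK _ _ h1, hK _ _ hx.1]

theorem continuous_lintegral_displacement {l : EqRelSpace Γ → Γ → ℝ} {K : Finset Γ}
    (hc : ∀ g, Continuous fun r => l r g) (hK : ∀ r, ∀ g ∉ K, l r g = 0) (s : Γ) :
    Continuous fun ρ : ProbabilityMeasure (EqRelSpace Γ) =>
      ∫⁻ r in {r | r.1 (1, s) = true}, displacement l s r ∂ρ.toMeasure := by
  classical
  let F : EqRelSpace Γ → NNReal := fun r => {r : EqRelSpace Γ | r.1 (1, s) = true}.indicator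
    (fun r => ∑ x ∈ K ∪ K.image (s⁻¹ * ·), |l r (s * x) - l (shiftE s⁻¹ r) x|.toNNReal) r
  have hF : Continuous F := by
    refine Continuous.indicator (fun r hr => ?_) ?_
    · rw [(isClopen_related 1 s).frontier_eq] at hr
      exact absurd hr (Set.notMem_empty _)
    · refine continuous_finsetSum _ fun x _ => continuous_real_toNNReal.comp
        (continuous_abs.comp ((hc _).sub ((hc x).comp (continuous_shiftE _))))
  have hFeq : ∀ ρ : ProbabilityMeasure (EqRelSpace Γ),
      ∫⁻ r in {r | r.1 (1, s) = true}, displacement l s r ∂ρ.toMeasure =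
        ∫⁻ r, (BoundedContinuousFunction.mkOfCompact ⟨F, hF⟩) r ∂ρ.toMeasure := by
    intro ρ
    rw [← lintegral_indicator (measurableSet_related 1 s)]
    refine lintegral_congr fun r => ?_
    simp only [BoundedContinuousFunction.mkOfCompact_apply, ContinuousMap.coe_mk, F]
    by_cases hr : r ∈ {r : EqRelSpace Γ | r.1 (1, s) = true}
    · rw [Set.indicator_of_mem hr, Set.indicator_of_mem hr, displacement_eq_sum hK,
        ENNReal.ofNNReal_finsetSum]
      rfl
    · rw [Set.indicator_of_notMem hr, Set.indicator_of_notMem hr, ENNReal.coe_zero]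
  simp_rw [hFeq]
  rw [continuous_iff_continuousAt]
  exact fun ρ => ProbabilityMeasure.tendsto_iff_forall_lintegral_tendsto.1 tendsto_id _

/-- If limits of finite invariant random equivalence relations are amenable, then finite ones are
amenable uniformly, with supports in a common finite set. -/
theorem exists_uniform_probField
    (hcl : closure {ρ : ProbabilityMeasure (EqRelSpace Γ) | IsFIRE ρ} ⊆ {ρ | IsAIRE ρ})
    (S : Finset Γ) {ε : ℝ≥0∞} (hε : 0 < ε) :
    ∃ K : Finset Γ, ∀ ρ : ProbabilityMeasure (EqRelSpace Γ), IsFIRE ρ →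
      ∃ l, IsProbField l ∧ (∀ r, ∀ g ∉ K, l r g = 0) ∧
        ∑ s ∈ S, ∫⁻ r in {r | r.1 (1, s) = true}, displacement l s r ∂ρ.toMeasure ≤ ε := by
  classical
  by_contra! hcon
  choose ρ hρ hbad using hcon
  obtain ⟨μ, hμ⟩ := exists_clusterPt_of_compactSpace (map ρ atTop)
  have hμcl : μ ∈ closure {ρ : ProbabilityMeasure (EqRelSpace Γ) | IsFIRE ρ} :=
    mem_closure_iff_clusterPt.2 (hμ.mono (le_principal_iff.2
      (mem_map.2 (Eventually.of_forall hρ))))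
  have hμA : IsAIRE μ := hcl hμcl
  obtain ⟨lam, hl, hlim⟩ := hμA.exists_tendsto_lintegral
  obtain ⟨d, hd0, hd⟩ : ∃ d : ℝ≥0∞, 0 < d ∧ S.card * (d + 8 * d) < ε := by
    have : Tendsto (fun d : ℝ≥0∞ => S.card * (d + 8 * d)) (𝓝[>] 0) (𝓝 0) := by
      have h : Continuous fun d : ℝ≥0∞ => S.card * (d + 8 * d) :=
        ENNReal.continuous_const_mul (ENNReal.natCast_ne_top _) |>.comp
          (continuous_id.add (ENNReal.continuous_const_mul (by norm_num)))
      simpa using (h.tendsto 0).mono_left nhdsWithin_le_nhds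
    obtain ⟨d, h1, h2⟩ := ((this.eventually_lt_const hε).and self_mem_nhdsWithin).exists
    exact ⟨d, h2, h1⟩
  obtain ⟨n, hn⟩ : ∃ n, ∀ s ∈ S,
      ∫⁻ r in {r | r.1 (1, s) = true}, displacement (lam n) s r ∂μ.toMeasure ≤ d :=
    ((Finset.eventually_all S).2 fun s _ => (hlim s).eventually_le_const hd0).exists
  obtain ⟨K, l', hl', hc', hK', hδ⟩ := (hl n).exists_continuous_approx μ hd0
  have hcost : ∑ s ∈ S, ∫⁻ r in {r | r.1 (1, s) = true}, displacement l' s r ∂μ.toMeasure < ε := by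
    refine lt_of_le_of_lt (Finset.sum_le_card_nsmul S _ (d + 8 * d) fun s hs => ?_) ?_
    · refine (hμA.1.lintegral_displacement_le (hl n) hl' s).trans ?_
      refine add_le_add (hn s hs) ((mul_le_mul_right hδ 2).trans (le_of_eq ?_))
      rw [← mul_assoc]
      norm_num
    · rwa [nsmul_eq_mul]
  have hcont : Continuous fun ρ : ProbabilityMeasure (EqRelSpace Γ) =>
      ∑ s ∈ S, ∫⁻ r in {r | r.1 (1, s) = true}, displacement l' s r ∂ρ.toMeasure :=
    continuous_finsetSum _ fun s _ => continuous_lintegral_displacement hc' hK' s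
  have hfreq : ∃ᶠ J in atTop, ∑ s ∈ S, ∫⁻ r in {r | r.1 (1, s) = true},
      displacement l' s r ∂(ρ J).toMeasure < ε :=
    MapClusterPt.frequently hμ (hcont.continuousAt.eventually_lt_const hcost)
  obtain ⟨J, hJ, hKJ⟩ := (hfreq.and_eventually (eventually_ge_atTop K)).exists
  exact (hbad J l' hl' fun r g hg => hK' r g fun h => hg (hKJ h)).not_ge hJ.le

end UniformAmenability

section FiniteWindows

/-- A probability vector on `Γ` supported in the finite set `K`. -/
structure IsProbOn (K : Finset Γ) (p : Γ → ℝ) : Prop where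
  nonneg : ∀ x, 0 ≤ p x
  eq_zero : ∀ x ∉ K, p x = 0
  tsum_eq : ∑' x, p x = 1

/-- The `ℓ¹` distance between `s⁻¹ · p` and `q`. -/
noncomputable def shiftDist (s : Γ) (p q : Γ → ℝ) : ℝ≥0∞ :=
  ∑' x, ENNReal.ofReal |p (s * x) - q x|

theorem IsProbOn.shiftDist_le_two {K : Finset Γ} {p q : Γ → ℝ} (hp : IsProbOn K p)
    (hq : IsProbOn K q) (s : Γ) : shiftDist s p q ≤ 2 :=
  tsum_ofReal_abs_sub_le_two (fun _ => hp.nonneg _) hq.nonneg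
    (tsum_mul_left_eq s hp.tsum_eq) hq.tsum_eq

/-- The relation for which all elements are equivalent. -/
def fullRel (Γ : Type*) : EqRelSpace Γ := ⟨fun _ => true, by simp [IsEqRel]⟩

/-- The point mass at the full relation. -/
noncomputable def fullLaw (Γ : Type*) : ProbabilityMeasure (EqRelSpace Γ) :=
  ⟨Measure.dirac (fullRel Γ), inferInstance⟩

theorem fullLaw_toMeasure : (fullLaw Γ).toMeasure = Measure.dirac (fullRel Γ) := rfl

theorem isIRE_fullLaw : IsIRE (fullLaw Γ) := fun γ =>
  Measure.map_dirac' (measurable_shiftE γ) _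

open Classical in
/-- The acceptance thresholds for which `g` accepts each site of `g * L⁻¹` with
probability `q`. -/
noncomputable def windowThreshold (L : Finset Γ) (q : ℝ) (_ : EqRelSpace Γ) (x : Γ) : ℝ :=
  if x⁻¹ ∈ L then q else 0

theorem mem_acceptSet_windowThreshold {L : Finset Γ} {q : ℝ} {r : EqRelSpace Γ} {u : Γ → ℝ}
    (hu : ∀ x, 0 ≤ u x) (g b : Γ) :
    b ∈ acceptSet (windowThreshold L q) r u g ↔ b⁻¹ * g ∈ L ∧ u b < q := by
  have hinv : (g⁻¹ * b)⁻¹ = b⁻¹ * g := by group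
  simp only [acceptSet, windowThreshold, Set.mem_ofPred_eq]
  by_cases h : b⁻¹ * g ∈ L
  · rw [if_pos (hinv.symm ▸ h)]
    exact ⟨fun h' => ⟨h, h'⟩, And.right⟩
  · rw [if_neg (hinv.symm ▸ h)]
    exact ⟨fun h' => absurd h' (hu b).not_gt, fun h' => absurd h'.1 h⟩

theorem acceptSet_windowThreshold_eq_singleton {L : Finset Γ} {q : ℝ} {r : EqRelSpace Γ}
    {u : Γ → ℝ} (hu : ∀ x, 0 ≤ u x) {g : Γ} (hg : g ∈ L) (h1 : u 1 < q)
    (hb : ∀ b, b ≠ 1 → b⁻¹ * g ∈ L → q ≤ u b) :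
    acceptSet (windowThreshold L q) r u g = {1} := by
  ext b
  rw [mem_acceptSet_windowThreshold hu, Set.mem_singleton_iff]
  constructor
  · rintro ⟨h, h'⟩
    by_contra hne
    exact (hb b hne h).not_gt h'
  · rintro rfl
    simpa using ⟨hg, h1⟩

variable [Countable Γ]

theorem ae_labelLaw_nonneg : ∀ᵐ u ∂(labelLaw Γ), ∀ x, 0 ≤ u x := by
  refine ae_all_iff.2 fun x => ?_
  have h : ∀ᵐ t ∂unifLaw, (0 : ℝ) ≤ t := by
    filter_upwards [ae_restrict_mem measurableSet_Icc] with t ht using ht.1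
  exact (measurePreserving_eval_labelLaw x).quasiMeasurePreserving.ae h

theorem labelLaw_lt_lt {b : Γ} (hb : b ≠ 1) (q : ℝ) :
    labelLaw Γ {u | u 1 < q ∧ u b < q} ≤ ENNReal.ofReal q ^ 2 := by
  classical
  calc _ ≤ labelLaw Γ (Set.pi ({1, b} : Finset Γ) fun _ => Set.Iio q) := by
        refine measure_mono fun u hu x hx => ?_
        simp only [Finset.coe_insert, Finset.coe_singleton, Set.mem_insert_iff,
          Set.mem_singleton_iff] at hx
        rcases hx with rfl | rfl
        · exact hu.1
        · exact hu.2
    _ = ∏ x ∈ ({1, b} : Finset Γ), unifLaw (Set.Iio q) :=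
        Measure.infinitePi_pi _ fun x _ => measurableSet_Iio
    _ ≤ _ := by
        rw [Finset.prod_pair hb.symm, sq]
        gcongr <;> exact unifLaw_Iio_le q

theorem measurable_windowThreshold (L : Finset Γ) (q : ℝ) (g : Γ) :
    Measurable fun r : EqRelSpace Γ => windowThreshold L q r g :=
  measurable_const

/-- The finite random equivalence relation obtained from the full relation by thinning along
translates of `L`. -/
noncomputable def windowLaw (L : Finset Γ) (q : ℝ) : ProbabilityMeasure (EqRelSpace Γ) :=
  thinLaw (fullLaw Γ) (measurable_windowThreshold L q)

theorem isFIRE_windowLaw (L : Finset Γ) (q : ℝ) : IsFIRE (windowLaw L q) := by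
  classical
  refine isFIRE_thinLaw isIRE_fullLaw _
    (T := ∑ x ∈ L.image (·⁻¹), ENNReal.ofReal q) (ENNReal.sum_ne_top.2 fun _ _ => by simp)
    fun r => ?_
  rw [tsum_eq_sum (s := L.image (·⁻¹))]
  · refine Finset.sum_le_sum fun x hx => ENNReal.ofReal_le_ofReal ?_
    obtain ⟨y, hy, rfl⟩ := Finset.mem_image.1 hx
    simp [windowThreshold, hy]
  · intro x hx
    have : x⁻¹ ∉ L := fun h => hx (Finset.mem_image.2 ⟨_, h, inv_inv x⟩)
    simp [windowThreshold, this]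

theorem lintegral_windowLaw (L : Finset Γ) (q : ℝ) {F : EqRelSpace Γ → ℝ≥0∞} (hF : Measurable F) :
    ∫⁻ r, F r ∂(windowLaw L q).toMeasure =
      ∫⁻ u, F (thin (windowThreshold L q) (fullRel Γ, u)) ∂(labelLaw Γ) := by
  have hm := measurable_thin (measurable_windowThreshold (Γ := Γ) L q)
  rw [windowLaw, thinLaw_toMeasure, lintegral_map hF hm, fullLaw_toMeasure, Measure.dirac_prod]
  exact lintegral_map (hF.comp hm) measurable_prodMk_left

/-- The cost of the field `ξ` at `g`, counting only the moves that stay inside `L`. -/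
noncomputable def innerCost [DecidableEq Γ] (S L : Finset Γ) (ξ : Γ → Γ → ℝ) (g : Γ) : ℝ≥0∞ :=
  ∑ s ∈ S, if g * s ∈ L then shiftDist s (ξ g) (ξ (g * s)) else 0

theorem exists_innerCost_le [DecidableEq Γ]
    (hcl : closure {ρ : ProbabilityMeasure (EqRelSpace Γ) | IsFIRE ρ} ⊆ {ρ | IsAIRE ρ})
    (S : Finset Γ) {ε : ℝ} (hε : 0 < ε) :
    ∃ K : Finset Γ, ∀ L : Finset Γ, ∃ ξ : Γ → Γ → ℝ, (∀ g, IsProbOn K (ξ g)) ∧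
      ∑ g ∈ L, innerCost S L ξ g ≤ ENNReal.ofReal ε * L.card := by
  obtain ⟨p, hp0, hp1, hp⟩ : ∃ p : ℝ, 0 < p ∧ p ≤ 1 ∧ 4 * S.card * p ≤ ε / 4 := by
    refine ⟨min 1 (ε / (16 * (S.card + 1))), by positivity, min_le_left _ _, ?_⟩
    calc 4 * (S.card : ℝ) * min 1 (ε / (16 * (S.card + 1)))
        ≤ 4 * (S.card + 1) * (ε / (16 * (S.card + 1))) := by
          gcongr
          · linarith
          · exact min_le_right _ _
      _ = ε / 4 := by field_simp; norm_num
  obtain ⟨K, hK⟩ := exists_uniform_probField hcl S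
    (ε := ENNReal.ofReal (ε * p / 4)) (ENNReal.ofReal_pos.2 (by positivity))
  refine ⟨K, fun L => ?_⟩
  set q : ℝ := p / L.card with hq
  obtain ⟨l, hl, hlK, hcost⟩ := hK (windowLaw L q) (isFIRE_windowLaw L q)
  have hprob : ∀ r, IsProbOn K (l r) := fun r => ⟨hl.nonneg r, hlK r, hl.tsum_eq r⟩
  rcases L.eq_empty_or_nonempty with rfl | hL
  · exact ⟨fun _ => l (fullRel Γ), fun _ => hprob _, by simp⟩
  have hLpos : (0 : ℝ) < L.card := by exact_mod_cast hL.card_pos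
  have hL1 : (1 : ℝ) ≤ L.card := by exact_mod_cast hL.card_pos
  have hq0 : 0 < q := div_pos hp0 hLpos
  have hq1 : q ≤ 1 := (div_le_one hLpos).2 (hp1.trans hL1)
  let R : (Γ → ℝ) → EqRelSpace Γ := fun u => thin (windowThreshold L q) (fullRel Γ, u)
  have hR : Measurable R :=
    (measurable_thin (measurable_windowThreshold L q)).comp measurable_prodMk_left
  have hRshift : ∀ g u, R (shiftLabel g u) = shiftE g (R u) := fun g u =>
    thin_shift (windowThreshold L q) g (fullRel Γ) u
  let ξ : (Γ → ℝ) → Γ → Γ → ℝ := fun u g => l (shiftE g⁻¹ (R u))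
  by_contra! hcon
  let X : (Γ → ℝ) → ℝ≥0∞ := fun v => ∑ s ∈ S,
    {r : EqRelSpace Γ | r.1 (1, s) = true}.indicator (displacement l s) (R v)
  let M : Γ → Set (Γ → ℝ) := fun g =>
    {v | acceptSet (windowThreshold L q) (fullRel Γ) v 1 = {g⁻¹}}
  let B : Γ → Finset Γ := fun g => (L.image fun x => g * x⁻¹).erase 1
  let Y : Γ → Γ → (Γ → ℝ) → ℝ≥0∞ := fun g s u => ∑ b ∈ B g ∪ B (g * s),
    {u : Γ → ℝ | u 1 < q ∧ u b < q}.indicator (fun _ => 2) u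
  have hXm : Measurable X := by
    refine Finset.measurable_fun_sum _ fun s _ => ?_
    exact ((measurable_displacement hl.measurable s).indicator (measurableSet_related 1 s)).comp hR
  have hXint : ∫⁻ v, X v ∂(labelLaw Γ) ≤ ENNReal.ofReal (ε * p / 4) := by
    refine le_trans (le_of_eq ?_) hcost
    have hm : ∀ s, Measurable ({r : EqRelSpace Γ | r.1 (1, s) = true}.indicator
        (displacement l s)) := fun s =>
      (measurable_displacement hl.measurable s).indicator (measurableSet_related 1 s)
    refine (lintegral_finsetSum _ fun s _ => (hm s).comp hR).trans ?_
    refine Finset.sum_congr rfl fun s _ => ?_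
    rw [← lintegral_indicator (measurableSet_related 1 s), lintegral_windowLaw L q (hm s)]
    rfl
  have hMm : ∀ g, MeasurableSet (M g) := by
    intro g
    simp only [M, Set.ext_iff]
    rw [Set.ofPred_forall]
    refine MeasurableSet.iInter fun x => MeasurableSet.iff ?_ (MeasurableSet.const _)
    exact measurableSet_lt (measurable_pi_apply x) measurable_const
  have hMdisj : ∀ v, ∑ g ∈ L, (M g).indicator X v ≤ X v := by
    intro v
    rw [← Finset.indicator_biUnion_apply]
    · exact Set.indicator_le_self _ _ _
    · intro g _ g' _ hne
      refine Set.disjoint_left.2 fun w hw hw' => hne ?_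
      simp only [M, Set.mem_ofPred_eq] at hw hw'
      exact inv_injective (Set.singleton_injective (hw.symm.trans hw'))
  have hrel : ∀ u : Γ → ℝ, (∀ x, 0 ≤ u x) → u 1 < q → ∀ g ∈ L, ∀ s ∈ S, g * s ∈ L →
      (∀ b ∈ B g ∪ B (g * s), q ≤ u b) →
      shiftLabel g⁻¹ u ∈ M g ∧ (R (shiftLabel g⁻¹ u)).1 (1, s) = true := by
    intro u hu hu1 g hg s hs hgs hb
    have hmem : ∀ h b : Γ, b ≠ 1 → b⁻¹ * h ∈ L → b ∈ B h := fun h b h1 h2 =>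
      Finset.mem_erase.2 ⟨h1, Finset.mem_image.2 ⟨_, h2, by group⟩⟩
    have h1 := acceptSet_windowThreshold_eq_singleton (r := fullRel Γ) hu hg hu1
      fun b h h' => hb b (Finset.mem_union_left _ (hmem _ b h h'))
    have h2 := acceptSet_windowThreshold_eq_singleton (r := fullRel Γ) hu hgs hu1
      fun b h h' => hb b (Finset.mem_union_right _ (hmem _ b h h'))
    constructor
    · simp only [M, Set.mem_ofPred_eq]
      have h3 := acceptSet_shift (windowThreshold L q) (fullRel Γ) u g⁻¹ 1
      rw [inv_inv, mul_one, h1] at h3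
      refine h3.trans ?_
      ext x
      simp
    · rw [hRshift, shiftE_apply, inv_inv, mul_one]
      exact (thin_apply _ _ _ _ _).2 (Or.inr ⟨rfl, h1.trans h2.symm, h1 ▸ ⟨1, rfl⟩⟩)
  have hpt : ∀ u : Γ → ℝ, (∀ x, 0 ≤ u x) → u 1 < q →
      ∑ g ∈ L, innerCost S L (ξ u) g ≤
        ∑ g ∈ L, (M g).indicator X (shiftLabel g⁻¹ u) + ∑ g ∈ L, ∑ s ∈ S, Y g s u := by
    intro u hu hu1
    rw [← Finset.sum_add_distrib]
    refine Finset.sum_le_sum fun g hg => ?_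
    have hX : (M g).indicator X (shiftLabel g⁻¹ u) = ∑ s ∈ S, (M g).indicator (fun v =>
        {r : EqRelSpace Γ | r.1 (1, s) = true}.indicator (displacement l s) (R v))
          (shiftLabel g⁻¹ u) := by
      by_cases h : shiftLabel g⁻¹ u ∈ M g
      · simp only [Set.indicator_of_mem h, X]
      · simp only [Set.indicator_of_notMem h, Finset.sum_const_zero]
    rw [hX, ← Finset.sum_add_distrib]
    refine Finset.sum_le_sum fun s hs => ?_
    split_ifs with hgs
    · by_cases hb : ∀ b ∈ B g ∪ B (g * s), q ≤ u b
      · obtain ⟨h1, h2⟩ := hrel u hu hu1 g hg s hs hgs hb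
        rw [Set.indicator_of_mem h1, Set.indicator_of_mem (by exact h2), hRshift]
        refine le_add_right (le_of_eq ?_)
        simp only [ξ, mul_inv_rev, shiftE_mul]
        rfl
      · push Not at hb
        obtain ⟨b, hbB, hbq⟩ := hb
        refine le_add_left (((hprob _).shiftDist_le_two (hprob _) s).trans ?_)
        refine le_trans (le_of_eq ?_) (Finset.single_le_sum
          (f := fun b => {u : Γ → ℝ | u 1 < q ∧ u b < q}.indicator (fun _ => (2 : ℝ≥0∞)) u)
          (fun _ _ => zero_le) hbB)
        have hmem : u ∈ {u : Γ → ℝ | u 1 < q ∧ u b < q} := ⟨hu1, hbq⟩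
        exact (Set.indicator_of_mem hmem fun _ => (2 : ℝ≥0∞)).symm
    · exact zero_le
  have hYint : ∀ g s, ∫⁻ u, Y g s u ∂(labelLaw Γ) ≤ ENNReal.ofReal (4 * L.card * q ^ 2) := by
    intro g s
    have hm : ∀ b, MeasurableSet {u : Γ → ℝ | u 1 < q ∧ u b < q} := fun b =>
      (measurableSet_lt (measurable_pi_apply 1) measurable_const).inter
        (measurableSet_lt (measurable_pi_apply b) measurable_const)
    have hcard : (B g ∪ B (g * s)).card ≤ 2 * L.card := by
      have h : ∀ g, (B g).card ≤ L.card := fun g =>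
        (Finset.card_erase_le).trans Finset.card_image_le
      calc _ ≤ _ := Finset.card_union_le _ _
        _ ≤ _ := by linarith [h g, h (g * s)]
    calc ∫⁻ u, Y g s u ∂(labelLaw Γ) = ∑ b ∈ B g ∪ B (g * s),
          2 * labelLaw Γ {u | u 1 < q ∧ u b < q} := by
          refine (lintegral_finsetSum _ fun b _ => measurable_const.indicator (hm b)).trans ?_
          exact Finset.sum_congr rfl fun b _ => lintegral_indicator_const (hm b) 2
      _ ≤ ∑ b ∈ B g ∪ B (g * s), 2 * ENNReal.ofReal q ^ 2 := by
          refine Finset.sum_le_sum fun b hb => mul_le_mul_right (labelLaw_lt_lt ?_ q) _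
          rcases Finset.mem_union.1 hb with h | h <;> exact (Finset.mem_erase.1 h).1
      _ ≤ ((2 * L.card : ℕ) : ℝ≥0∞) * (2 * ENNReal.ofReal q ^ 2) := by
          rw [Finset.sum_const, nsmul_eq_mul]
          gcongr
      _ = _ := by
          rw [← ENNReal.ofReal_pow hq0.le, ← ENNReal.ofReal_natCast,
            ← ENNReal.ofReal_ofNat 2, ← ENNReal.ofReal_mul (by norm_num),
            ← ENNReal.ofReal_mul (by positivity)]
          congr 1
          push_cast
          ring
  have hupper : ∫⁻ u in {u | u 1 < q}, ∑ g ∈ L, innerCost S L (ξ u) g ∂(labelLaw Γ) ≤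
      ENNReal.ofReal (ε * p / 2) := by
    have hm1 : ∀ g, Measurable fun u => (M g).indicator X (shiftLabel g⁻¹ u) := fun g =>
      (hXm.indicator (hMm g)).comp (measurable_shiftLabel g⁻¹)
    have hYm : ∀ g s, Measurable (Y g s) := fun g s =>
      Finset.measurable_fun_sum _ fun b _ => measurable_const.indicator
        ((measurableSet_lt (measurable_pi_apply 1) measurable_const).inter
        (measurableSet_lt (measurable_pi_apply b) measurable_const))
    calc _ ≤ ∫⁻ u in {u | u 1 < q}, (∑ g ∈ L, (M g).indicator X (shiftLabel g⁻¹ u) +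
          ∑ g ∈ L, ∑ s ∈ S, Y g s u) ∂(labelLaw Γ) := by
          refine setLIntegral_mono_ae'
            (measurableSet_lt (measurable_pi_apply 1) measurable_const) ?_
          filter_upwards [ae_labelLaw_nonneg] with u hu hu1 using hpt u hu hu1
      _ ≤ ∫⁻ u, (∑ g ∈ L, (M g).indicator X (shiftLabel g⁻¹ u) +
          ∑ g ∈ L, ∑ s ∈ S, Y g s u) ∂(labelLaw Γ) := setLIntegral_le_lintegral _ _
      _ = ∑ g ∈ L, ∫⁻ u, (M g).indicator X (shiftLabel g⁻¹ u) ∂(labelLaw Γ) +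
          ∑ g ∈ L, ∑ s ∈ S, ∫⁻ u, Y g s u ∂(labelLaw Γ) := by
          rw [lintegral_add_left (Finset.measurable_fun_sum _ fun g _ => hm1 g),
            lintegral_finsetSum _ fun g _ => hm1 g,
            lintegral_finsetSum _ fun g _ => Finset.measurable_fun_sum _ fun s _ => hYm g s]
          congr 1
          exact Finset.sum_congr rfl fun g _ => lintegral_finsetSum _ fun s _ => hYm g s
      _ ≤ ENNReal.ofReal (ε * p / 4) +
          ∑ g ∈ L, ∑ s ∈ S, ENNReal.ofReal (4 * L.card * q ^ 2) := by
          refine add_le_add ?_ (Finset.sum_le_sum fun g _ => Finset.sum_le_sum fun s _ =>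
            hYint g s)
          calc _ = ∑ g ∈ L, ∫⁻ v, (M g).indicator X v ∂(labelLaw Γ) :=
                Finset.sum_congr rfl fun g _ =>
                  (measurePreserving_shiftLabel g⁻¹).lintegral_comp (hXm.indicator (hMm g))
            _ = ∫⁻ v, ∑ g ∈ L, (M g).indicator X v ∂(labelLaw Γ) :=
                (lintegral_finsetSum _ fun g _ => hXm.indicator (hMm g)).symm
            _ ≤ _ := (lintegral_mono hMdisj).trans hXint
      _ = ENNReal.ofReal (ε * p / 4 + 4 * S.card * p * p) := by
          rw [Finset.sum_const, Finset.sum_const, nsmul_eq_mul, nsmul_eq_mul,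
            ← ENNReal.ofReal_natCast, ← ENNReal.ofReal_natCast,
            ← ENNReal.ofReal_mul (by positivity), ← ENNReal.ofReal_mul (by positivity),
            ← ENNReal.ofReal_add (by positivity) (by positivity), hq]
          congr 2
          field_simp
      _ ≤ _ := ENNReal.ofReal_le_ofReal (by nlinarith)
  have hlower : ENNReal.ofReal (ε * p) ≤
      ∫⁻ u in {u | u 1 < q}, ∑ g ∈ L, innerCost S L (ξ u) g ∂(labelLaw Γ) := by
    have hmeas : labelLaw Γ {u | u 1 < q} = ENNReal.ofReal q := by
      rw [← unifLaw_Iio hq1]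
      exact (measurePreserving_eval_labelLaw (1 : Γ)).measure_preimage
        measurableSet_Iio.nullMeasurableSet
    calc _ = ∫⁻ u in {u | u 1 < q}, ENNReal.ofReal ε * L.card ∂(labelLaw Γ) := by
          rw [setLIntegral_const, hmeas, ← ENNReal.ofReal_natCast,
            ← ENNReal.ofReal_mul hε.le, ← ENNReal.ofReal_mul (by positivity), hq]
          congr 1
          field_simp
      _ ≤ _ := lintegral_mono fun u => (hcon (ξ u) fun g => hprob _).le
  exact ((ENNReal.ofReal_lt_ofReal_iff (by positivity)).2 (by nlinarith [mul_pos hε hp0])).not_ge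
    (hlower.trans hupper)

end FiniteWindows

section Weights

theorem Int.ediv_add_one_eq_of_not_dvd {N a : ℤ} (hN : 0 < N) (h : ¬ N ∣ a + 1) :
    (a + 1) / N = a / N := by
  have h1 : (a + 1) % N ≠ 0 := fun h' => h (Int.dvd_of_emod_eq_zero h')
  have h2 := Int.emod_nonneg (a + 1) hN.ne'
  have h3 := Int.emod_lt_of_pos (a + 1) hN
  have h4 := Int.emod_add_mul_ediv (a + 1) N
  refine ((Int.ediv_emod_unique hN (r := (a + 1) % N - 1)).2 ⟨?_, ?_, ?_⟩).1.symm
  · linarith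
  · omega
  · omega

theorem card_filter_ediv_ne_le_one {N : ℕ} (hN : 0 < N) {a b : ℤ} (hab : |a - b| ≤ 1) :
    ((Finset.range N).filter fun j : ℕ => (a + j) / N ≠ (b + j) / N).card ≤ 1 := by
  have hN' : (0 : ℤ) < N := by exact_mod_cast hN
  have key : ∀ {a b : ℤ}, b = a + 1 →
      ((Finset.range N).filter fun j : ℕ => (a + j) / N ≠ (b + j) / N).card ≤ 1 := by
    rintro a b rfl
    refine Finset.card_le_one.2 fun i hi j hj => ?_
    have hdvd : ∀ j ∈ (Finset.range N).filter fun j : ℕ => (a + j) / N ≠ (a + 1 + j) / N,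
        (N : ℤ) ∣ a + j + 1 := by
      intro j hj
      by_contra h
      refine (Finset.mem_filter.1 hj).2 ?_
      rw [← Int.ediv_add_one_eq_of_not_dvd hN' h, add_right_comm]
    have h1 := dvd_sub (hdvd i hi) (hdvd j hj)
    have h2 : a + i + 1 - (a + j + 1) = (i : ℤ) - j := by ring
    rw [h2] at h1
    have hi' := Finset.mem_range.1 (Finset.mem_filter.1 hi).1
    have hj' := Finset.mem_range.1 (Finset.mem_filter.1 hj).1
    have h3 := Int.eq_zero_of_abs_lt_dvd h1 (by rw [abs_lt]; omega)
    omega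
  rw [abs_le] at hab
  have hcases : b = a + 1 ∨ a = b + 1 ∨ a = b := by omega
  rcases hcases with h | h | h
  · exact key h
  · exact (congrArg Finset.card (Finset.filter_congr fun j _ => ne_comm)).trans_le (key h)
  · simp [h]

/-- The sum of `f` over the right translates by elements of `S`. -/
noncomputable def translateSum (S : Finset Γ) (f : Γ → ℝ≥0∞) (g : Γ) : ℝ≥0∞ :=
  ∑ s ∈ S, f (g * s)

theorem tsum_translateSum_iterate (S : Finset Γ) (f : Γ → ℝ≥0∞) (n : ℕ) :
    ∑' g, (translateSum S)^[n] f g = S.card ^ n * ∑' g, f g := by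
  induction n with
  | zero => simp
  | succ n ih =>
    rw [Function.iterate_succ_apply']
    simp only [translateSum]
    rw [Summable.tsum_finsetSum fun _ _ => ENNReal.summable]
    have h : ∀ s ∈ S, ∑' g, (translateSum S)^[n] f (g * s) = S.card ^ n * ∑' g, f g := by
      intro s _
      rw [← ih]
      exact (Equiv.mulRight s).tsum_eq ((translateSum S)^[n] f)
    rw [Finset.sum_congr rfl h, Finset.sum_const, nsmul_eq_mul, pow_succ', mul_assoc]

/-- Every weight is dominated by one of comparable mass which is almost constant up to a
bounded factor under right translation by `S`. -/
theorem exists_smooth_weight (S : Finset Γ) : ∃ M : ℕ, 2 ≤ M ∧ ∀ μ : Γ → ℝ≥0∞,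
    ∃ ν : Γ → ℝ≥0∞, (∀ g, μ g ≤ ν g) ∧ ∑' g, ν g = 2 * ∑' g, μ g ∧
      ∀ g, ∀ s ∈ S, ν (g * s) ≤ M * ν g ∧ ν g ≤ M * ν (g * s) := by
  classical
  let S' : Finset Γ := insert 1 (S ∪ S.image (·⁻¹))
  have hcard : 0 < S'.card := Finset.card_pos.2 ⟨1, Finset.mem_insert_self _ _⟩
  let M : ℕ := 2 * S'.card
  have hM0 : (M : ℝ≥0∞) ≠ 0 := by
    rw [Nat.cast_ne_zero]
    omega
  have hMt : (M : ℝ≥0∞) ≠ ∞ := ENNReal.natCast_ne_top M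
  refine ⟨M, by omega, fun μ => ⟨fun g => ∑' n, (M : ℝ≥0∞)⁻¹ ^ n * (translateSum S')^[n] μ g,
    fun g => ?_, ?_, ?_⟩⟩
  · refine le_trans (le_of_eq ?_) (ENNReal.le_tsum 0)
    simp
  · rw [ENNReal.tsum_comm]
    simp_rw [ENNReal.tsum_mul_left, tsum_translateSum_iterate, ← mul_assoc, ← mul_pow]
    have h2 : (M : ℝ≥0∞)⁻¹ * S'.card = 2⁻¹ := by
      have h0 : (S'.card : ℝ≥0∞) ≠ 0 := Nat.cast_ne_zero.2 hcard.ne'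
      simp only [M, Nat.cast_mul, Nat.cast_ofNat]
      rw [ENNReal.mul_inv (Or.inl two_ne_zero) (Or.inl (by norm_num)), mul_assoc,
        ENNReal.inv_mul_cancel h0 (ENNReal.natCast_ne_top _), mul_one]
    rw [ENNReal.tsum_mul_right, h2, ENNReal.tsum_geometric, ENNReal.one_sub_inv_two, inv_inv]
  · have key : ∀ g, ∀ s ∈ S', ∑' n, (M : ℝ≥0∞)⁻¹ ^ n * (translateSum S')^[n] μ (g * s) ≤
        M * ∑' n, (M : ℝ≥0∞)⁻¹ ^ n * (translateSum S')^[n] μ g := by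
      intro g s hs
      calc _ ≤ ∑' n, M * ((M : ℝ≥0∞)⁻¹ ^ (n + 1) * (translateSum S')^[n + 1] μ g) := by
            refine ENNReal.tsum_le_tsum fun n => ?_
            rw [pow_succ', mul_assoc, ← mul_assoc (M : ℝ≥0∞), ENNReal.mul_inv_cancel hM0 hMt,
              one_mul, Function.iterate_succ_apply']
            gcongr
            exact Finset.single_le_sum (f := fun s => (translateSum S')^[n] μ (g * s))
              (fun _ _ => zero_le) hs
        _ ≤ _ := by
            rw [ENNReal.tsum_mul_left]
            exact mul_le_mul_right (ENNReal.tsum_comp_le_tsum_of_injective Nat.succ_injective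
              fun n => (M : ℝ≥0∞)⁻¹ ^ n * (translateSum S')^[n] μ g) _
    intro g s hs
    refine ⟨key g s (by simp [S', hs]), ?_⟩
    simpa using key (g * s) s⁻¹ (by simp [S', hs])

/-- The cost of the field `ξ` at `g`. -/
noncomputable def fieldCost (S : Finset Γ) (ξ : Γ → Γ → ℝ) (g : Γ) : ℝ≥0∞ :=
  ∑ s ∈ S, shiftDist s (ξ g) (ξ (g * s))

theorem exists_le_of_sum_range_le {N : ℕ} (hN : 0 < N) {f : ℕ → ℝ≥0∞} {C : ℝ≥0∞}
    (h : ∑ j ∈ Finset.range N, f j ≤ C) : ∃ j < N, N * f j ≤ C := by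
  obtain ⟨j, hj, hmin⟩ := (Finset.range N).exists_min_image f ⟨0, Finset.mem_range.2 hN⟩
  refine ⟨j, Finset.mem_range.1 hj, le_trans ?_ h⟩
  have := Finset.card_nsmul_le_sum (Finset.range N) f (f j) hmin
  rwa [Finset.card_range, nsmul_eq_mul] at this

variable [Countable Γ]

theorem exists_sum_mul_fieldCost_le
    (hcl : closure {ρ : ProbabilityMeasure (EqRelSpace Γ) | IsFIRE ρ} ⊆ {ρ | IsAIRE ρ})
    (S : Finset Γ) {ε : ℝ} (hε : 0 < ε) :
    ∃ K : Finset Γ, ∀ (F : Finset Γ) (μ : Γ → ℝ≥0∞), ∑' g, μ g ≠ ∞ →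
      ∃ ξ : Γ → Γ → ℝ, (∀ g, IsProbOn K (ξ g)) ∧
        ∑ g ∈ F, μ g * fieldCost S ξ g ≤ ENNReal.ofReal ε * ∑' g, μ g := by
  classical
  obtain ⟨M, hM2, hM⟩ := exists_smooth_weight S
  have hM1 : (1 : ℝ≥0∞) < M := by exact_mod_cast hM2
  have hM0 : (M : ℝ≥0∞) ≠ 0 := (zero_lt_one.trans hM1).ne'
  have hMt : (M : ℝ≥0∞) ≠ ∞ := ENNReal.natCast_ne_top M
  obtain ⟨N, hN⟩ := exists_nat_gt (4 * S.card / ε)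
  have hN0' : (0 : ℝ) < N := lt_of_le_of_lt (by positivity) hN
  have hN0 : 0 < N := by exact_mod_cast hN0'
  have hMpos : (0 : ℝ) < M := by exact_mod_cast (by omega : 0 < M)
  obtain ⟨K, hK⟩ := exists_innerCost_le hcl S (ε := ε / (4 * M ^ N)) (by positivity)
  refine ⟨K, fun F μ hμ => ?_⟩
  obtain ⟨ν, hμν, hνsum, hν⟩ := hM μ
  have hνt : ∀ g, ν g ≠ ∞ := fun g => by
    refine ne_top_of_le_ne_top ?_ (ENNReal.le_tsum g)
    rw [hνsum]
    exact ENNReal.mul_ne_top (by norm_num) hμ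
  -- logarithmic levels of the smoothed weight
  have hlevel : ∀ g, ∃ h : ℤ, ν g ≠ 0 → (M : ℝ≥0∞) ^ h ≤ ν g ∧ ν g < (M : ℝ≥0∞) ^ (h + 1) := by
    intro g
    by_cases h0 : ν g = 0
    · exact ⟨0, fun h => absurd h0 h⟩
    · obtain ⟨n, hn⟩ := ENNReal.exists_mem_Ico_zpow h0 (hνt g) hM1 hMt
      exact ⟨n, fun _ => hn⟩
  choose h hh using hlevel
  have hsucc : ∀ k : ℤ, (M : ℝ≥0∞) * (M : ℝ≥0∞) ^ k = (M : ℝ≥0∞) ^ (k + 1) := fun k => by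
    rw [ENNReal.zpow_add hM0 hMt, zpow_one, mul_comm]
  have hcmp : ∀ g g', ν g ≠ 0 → ν g' ≠ 0 → ν g' ≤ M * ν g → h g' ≤ h g + 1 := by
    intro g g' h0 h0' hle
    by_contra! hlt
    refine ((hh g' h0').1.trans hle).not_gt ?_
    calc M * ν g < M * (M : ℝ≥0∞) ^ (h g + 1) :=
          (ENNReal.mul_lt_mul_iff_right hM0 hMt).2 (hh g h0).2
      _ = (M : ℝ≥0∞) ^ (h g + 1 + 1) := hsucc _
      _ ≤ _ := ENNReal.zpow_le_of_le hM1.le hlt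
  have hνs : ∀ g, ∀ s ∈ S, ν g ≠ 0 → ν (g * s) ≠ 0 := fun g s hs h0 h0' => by
    have := (hν g s hs).2
    rw [h0', mul_zero] at this
    exact h0 (le_antisymm this zero_le)
  have hlip : ∀ g, ∀ s ∈ S, ν g ≠ 0 → |h g - h (g * s)| ≤ 1 := by
    intro g s hs h0
    have h1 := hcmp g _ h0 (hνs g s hs h0) (hν g s hs).1
    have h2 := hcmp _ g (hνs g s hs h0) h0 (hν g s hs).2
    rw [abs_le]
    omega
  -- choice of the offset of the bands
  let cut : ℕ → Γ → ℕ := fun j g => (S.filter fun s => (h g + j) / N ≠ (h (g * s) + j) / N).card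
  have hcutsum : ∀ g, μ g * ∑ j ∈ Finset.range N, (cut j g : ℝ≥0∞) ≤ μ g * S.card := by
    intro g
    by_cases h0 : ν g = 0
    · have : μ g = 0 := le_antisymm (h0 ▸ hμν g) zero_le
      simp [this]
    · refine mul_le_mul_right ?_ _
      rw [← Nat.cast_sum, Nat.cast_le]
      simp only [cut, Finset.card_filter]
      rw [Finset.sum_comm]
      simp only [← Finset.card_filter]
      calc _ ≤ ∑ s ∈ S, 1 :=
            Finset.sum_le_sum fun s hs => card_filter_ediv_ne_le_one hN0 (hlip g s hs h0)
        _ = _ := by simp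
  obtain ⟨j, -, hj⟩ : ∃ j < N, N * ∑ g ∈ F, μ g * cut j g ≤ S.card * ∑' g, μ g := by
    refine exists_le_of_sum_range_le hN0 ?_
    rw [Finset.sum_comm]
    calc _ = ∑ g ∈ F, μ g * ∑ j ∈ Finset.range N, (cut j g : ℝ≥0∞) := by
          simp only [Finset.mul_sum]
      _ ≤ ∑ g ∈ F, μ g * S.card := Finset.sum_le_sum fun g _ => hcutsum g
      _ = S.card * ∑ g ∈ F, μ g := by rw [← Finset.sum_mul, mul_comm]
      _ ≤ _ := mul_le_mul_right (ENNReal.sum_le_tsum F) _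
  let band : Γ → ℤ := fun g => (h g + j) / N
  let G : Finset Γ := (F ∪ (F ×ˢ S).image fun p => p.1 * p.2).filter fun g => ν g ≠ 0
  let L : ℤ → Finset Γ := fun i => G.filter fun g => band g = i
  choose ξ hξ hξcost using fun i => hK (L i)
  refine ⟨fun g => ξ (band g) g, fun g => hξ _ g, ?_⟩
  have hpt : ∀ g ∈ F, μ g * fieldCost S (fun g => ξ (band g) g) g ≤
      μ g * innerCost S (L (band g)) (ξ (band g)) g + 2 * (μ g * cut j g) := by
    intro g hg
    by_cases h0 : ν g = 0
    · have : μ g = 0 := le_antisymm (h0 ▸ hμν g) zero_le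
      simp [this]
    rw [mul_left_comm, ← mul_add]
    refine mul_le_mul_right ?_ _
    have hcut : 2 * (cut j g : ℝ≥0∞) =
        ∑ s ∈ S, if (h g + j) / N ≠ (h (g * s) + j) / N then (2 : ℝ≥0∞) else 0 := by
      rw [← Finset.sum_filter, Finset.sum_const, nsmul_eq_mul, mul_comm]
    rw [hcut, fieldCost, innerCost, ← Finset.sum_add_distrib]
    refine Finset.sum_le_sum fun s hs => ?_
    by_cases hb : band g = band (g * s)
    · have hmem : g * s ∈ L (band g) :=
        Finset.mem_filter.2 ⟨Finset.mem_filter.2 ⟨Finset.mem_union_right _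
          (Finset.mem_image.2 ⟨(g, s), Finset.mem_product.2 ⟨hg, hs⟩, rfl⟩), hνs g s hs h0⟩,
          hb.symm⟩
      rw [if_pos hmem, ← hb]
      exact le_self_add
    · rw [if_pos (show (h g + j) / N ≠ (h (g * s) + j) / N from hb)]
      exact le_add_left ((hξ _ _).shiftDist_le_two (hξ _ _) s)
  have hband : ∀ i, ∑ g ∈ L i, ν g * innerCost S (L i) (ξ i) g ≤
      ENNReal.ofReal (ε / 4) * ∑ g ∈ L i, ν g := by
    intro i
    set B : ℝ≥0∞ := (M : ℝ≥0∞) ^ (N * i - j) with hB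
    have hbounds : ∀ g ∈ L i, B ≤ ν g ∧ ν g ≤ (M : ℝ≥0∞) ^ N * B := by
      intro g hg
      obtain ⟨hgG, hgi⟩ := Finset.mem_filter.1 hg
      obtain ⟨h1, h2⟩ := hh g (Finset.mem_filter.1 hgG).2
      have hNz : (0 : ℤ) < N := by exact_mod_cast hN0
      have h3 := Int.mul_ediv_self_le (x := h g + j) hNz.ne'
      have h4 := Int.lt_mul_ediv_self_add (x := h g + j) hNz
      have h5 : (h g + j) / N = i := hgi
      rw [h5] at h3 h4
      constructor
      · exact (ENNReal.zpow_le_of_le hM1.le (by linarith)).trans h1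
      · refine h2.le.trans ?_
        rw [hB, ← zpow_natCast, ← ENNReal.zpow_add hM0 hMt]
        exact ENNReal.zpow_le_of_le hM1.le (by linarith)
    calc _ ≤ ∑ g ∈ L i, (M : ℝ≥0∞) ^ N * B * innerCost S (L i) (ξ i) g :=
          Finset.sum_le_sum fun g hg => mul_le_mul_left (hbounds g hg).2 _
      _ ≤ (M : ℝ≥0∞) ^ N * B * (ENNReal.ofReal (ε / (4 * M ^ N)) * (L i).card) := by
          rw [← Finset.mul_sum]
          exact mul_le_mul_right (hξcost i) _
      _ = (M : ℝ≥0∞) ^ N * ENNReal.ofReal (ε / (4 * M ^ N)) * ((L i).card * B) := by ring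
      _ ≤ ENNReal.ofReal (ε / 4) * ∑ g ∈ L i, ν g := by
          refine mul_le_mul' (le_of_eq ?_) ?_
          · rw [← ENNReal.ofReal_natCast, ← ENNReal.ofReal_pow hMpos.le,
              ← ENNReal.ofReal_mul (by positivity)]
            congr 1
            field_simp
          · have := Finset.card_nsmul_le_sum (L i) ν B fun g hg => (hbounds g hg).1
            rwa [nsmul_eq_mul] at this
  have hinner : ∑ g ∈ F, μ g * innerCost S (L (band g)) (ξ (band g)) g ≤
      ENNReal.ofReal (ε / 4) * (2 * ∑' g, μ g) := by
    calc _ ≤ ∑ g ∈ F.filter fun g => ν g ≠ 0,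
          ν g * innerCost S (L (band g)) (ξ (band g)) g := by
          rw [Finset.sum_filter]
          refine Finset.sum_le_sum fun g _ => ?_
          split_ifs with h0
          · exact mul_le_mul_left (hμν g) _
          · rw [not_not] at h0
            have : μ g = 0 := le_antisymm (h0 ▸ hμν g) zero_le
            simp [this]
      _ ≤ ∑ g ∈ G, ν g * innerCost S (L (band g)) (ξ (band g)) g :=
          Finset.sum_le_sum_of_subset (Finset.filter_subset_filter _ Finset.subset_union_left)
      _ = ∑ i ∈ G.image band, ∑ g ∈ L i,
          ν g * innerCost S (L (band g)) (ξ (band g)) g :=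
          (Finset.sum_fiberwise_of_maps_to (fun g hg => Finset.mem_image_of_mem band hg) _).symm
      _ = ∑ i ∈ G.image band, ∑ g ∈ L i, ν g * innerCost S (L i) (ξ i) g := by
          refine Finset.sum_congr rfl fun i _ => Finset.sum_congr rfl fun g hg => ?_
          rw [(Finset.mem_filter.1 hg).2]
      _ ≤ ∑ i ∈ G.image band, ENNReal.ofReal (ε / 4) * ∑ g ∈ L i, ν g :=
          Finset.sum_le_sum fun i _ => hband i
      _ = ENNReal.ofReal (ε / 4) * ∑ g ∈ G, ν g := by
          rw [← Finset.mul_sum,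
            Finset.sum_fiberwise_of_maps_to fun g hg => Finset.mem_image_of_mem band hg]
      _ ≤ _ := by
          rw [← hνsum]
          exact mul_le_mul_right (ENNReal.sum_le_tsum G) _
  have hcutcost : ∑ g ∈ F, μ g * cut j g ≤ ENNReal.ofReal (ε / 4) * ∑' g, μ g := by
    have hNne : (N : ℝ≥0∞) ≠ 0 := Nat.cast_ne_zero.2 hN0.ne'
    refine (ENNReal.mul_le_mul_iff_right hNne (ENNReal.natCast_ne_top N)).1 (hj.trans ?_)
    rw [← mul_assoc]
    refine mul_le_mul_left ?_ _
    rw [← ENNReal.ofReal_natCast, ← ENNReal.ofReal_natCast, ← ENNReal.ofReal_mul hN0'.le]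
    refine ENNReal.ofReal_le_ofReal ?_
    rw [div_lt_iff₀ hε] at hN
    linarith
  calc _ ≤ ∑ g ∈ F, (μ g * innerCost S (L (band g)) (ξ (band g)) g + 2 * (μ g * cut j g)) :=
        Finset.sum_le_sum hpt
    _ ≤ ENNReal.ofReal (ε / 4) * (2 * ∑' g, μ g) +
        2 * (ENNReal.ofReal (ε / 4) * ∑' g, μ g) := by
        rw [Finset.sum_add_distrib, ← Finset.mul_sum]
        exact add_le_add hinner (mul_le_mul_right hcutcost _)
    _ = ENNReal.ofReal ε * ∑' g, μ g := by
        rw [mul_left_comm, ← two_mul, ← mul_assoc, ← mul_assoc, ← ENNReal.ofReal_ofNat 2,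
          ← ENNReal.ofReal_mul (by norm_num), ← ENNReal.ofReal_mul (by norm_num)]
        congr 2
        ring

end Weights

section Minimax

theorem IsProbOn.convexComb {K : Finset Γ} {p q : Γ → ℝ} (hp : IsProbOn K p) (hq : IsProbOn K q)
    {a b : ℝ} (ha : 0 ≤ a) (hb : 0 ≤ b) (hab : a + b = 1) : IsProbOn K (a • p + b • q) where
  nonneg x := add_nonneg (mul_nonneg ha (hp.nonneg x)) (mul_nonneg hb (hq.nonneg x))
  eq_zero x hx := by simp [hp.eq_zero x hx, hq.eq_zero x hx]
  tsum_eq := by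
    have h1 := summable_of_tsum_eq_one hp.tsum_eq
    have h2 := summable_of_tsum_eq_one hq.tsum_eq
    simp only [Pi.add_apply, Pi.smul_apply, smul_eq_mul]
    rw [(h1.mul_left a).tsum_add (h2.mul_left b), tsum_mul_left, tsum_mul_left, hp.tsum_eq,
      hq.tsum_eq, mul_one, mul_one, hab]

theorem shiftDist_convexComb_le (s : Γ) (p q p' q' : Γ → ℝ) {a b : ℝ} (ha : 0 ≤ a) (hb : 0 ≤ b) :
    shiftDist s (a • p + b • p') (a • q + b • q') ≤
      ENNReal.ofReal a * shiftDist s p q + ENNReal.ofReal b * shiftDist s p' q' := by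
  unfold shiftDist
  rw [← ENNReal.tsum_mul_left, ← ENNReal.tsum_mul_left, ← ENNReal.tsum_add]
  refine ENNReal.tsum_le_tsum fun x => ?_
  rw [← ENNReal.ofReal_mul ha, ← ENNReal.ofReal_mul hb,
    ← ENNReal.ofReal_add (by positivity) (by positivity)]
  refine ENNReal.ofReal_le_ofReal ?_
  simp only [Pi.add_apply, Pi.smul_apply, smul_eq_mul]
  rw [← abs_of_nonneg ha, ← abs_of_nonneg hb, ← abs_mul, ← abs_mul, abs_of_nonneg ha,
    abs_of_nonneg hb]
  refine le_trans (le_of_eq ?_) (abs_add_le _ _)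
  congr 1
  ring

theorem fieldCost_convexComb_le (S : Finset Γ) (ξ ξ' : Γ → Γ → ℝ) (g : Γ) {a b : ℝ} (ha : 0 ≤ a)
    (hb : 0 ≤ b) : fieldCost S (a • ξ + b • ξ') g ≤
      ENNReal.ofReal a * fieldCost S ξ g + ENNReal.ofReal b * fieldCost S ξ' g := by
  simp only [fieldCost]
  rw [Finset.mul_sum, Finset.mul_sum, ← Finset.sum_add_distrib]
  exact Finset.sum_le_sum fun s _ => shiftDist_convexComb_le s _ _ _ _ ha hb

theorem fieldCost_ne_top {S K : Finset Γ} {ξ : Γ → Γ → ℝ} (hξ : ∀ g, IsProbOn K (ξ g)) (g : Γ) :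
    fieldCost S ξ g ≠ ∞ :=
  ENNReal.sum_ne_top.2 fun s _ =>
    ne_top_of_le_ne_top ENNReal.ofNat_ne_top ((hξ g).shiftDist_le_two (hξ _) s)

/-- Minimax principle: if weighted sums of costs can be made small for all weights, then the costs
can be made uniformly small. -/
theorem exists_forall_mem_fieldCost_le {S K F : Finset Γ} {ε : ℝ} (hε : 0 < ε)
    (hW : ∀ μ : Γ → ℝ≥0∞, ∑' g, μ g ≠ ∞ → ∃ ξ : Γ → Γ → ℝ, (∀ g, IsProbOn K (ξ g)) ∧
      ∑ g ∈ F, μ g * fieldCost S ξ g ≤ ENNReal.ofReal (ε / 2) * ∑' g, μ g) :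
    ∃ ξ : Γ → Γ → ℝ, (∀ g, IsProbOn K (ξ g)) ∧
      ∀ g ∈ F, fieldCost S ξ g ≤ ENNReal.ofReal ε := by
  classical
  let O : Set (F → ℝ) := {v | ∀ g, v g < ε}
  let C : Set (F → ℝ) := {v | (∀ g, 0 ≤ v g) ∧ ∃ ξ : Γ → Γ → ℝ, (∀ g, IsProbOn K (ξ g)) ∧
    ∀ g : F, fieldCost S ξ g ≤ ENNReal.ofReal (v g)}
  have hO : IsOpen O := by
    simp only [O, Set.ofPred_forall]
    exact isOpen_iInter_of_finite fun g => isOpen_lt (continuous_apply g) continuous_const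
  have hOc : Convex ℝ O := by
    intro v hv w hw a b ha hb hab g
    exact (convex_Iio ε) (hv g) (hw g) ha hb hab
  have hCc : Convex ℝ C := by
    rintro v ⟨hv0, ξ, hξ, hv⟩ w ⟨hw0, ζ, hζ, hw⟩ a b ha hb hab
    refine ⟨fun g => add_nonneg (mul_nonneg ha (hv0 g)) (mul_nonneg hb (hw0 g)), a • ξ + b • ζ,
      fun g => (hξ g).convexComb (hζ g) ha hb hab, fun g => ?_⟩
    refine (fieldCost_convexComb_le S ξ ζ g ha hb).trans ?_
    simp only [Pi.add_apply, Pi.smul_apply, smul_eq_mul]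
    rw [ENNReal.ofReal_add (mul_nonneg ha (hv0 g)) (mul_nonneg hb (hw0 g)),
      ENNReal.ofReal_mul ha, ENNReal.ofReal_mul hb]
    gcongr
    · exact hv g
    · exact hw g
  by_contra! hcon
  have hdisj : Disjoint O C := by
    refine Set.disjoint_left.2 ?_
    rintro v hvO ⟨-, ξ, hξ, hv⟩
    obtain ⟨g, hg, hlt⟩ := hcon ξ hξ
    exact hlt.not_ge ((hv ⟨g, hg⟩).trans (ENNReal.ofReal_le_ofReal (hvO ⟨g, hg⟩).le))
  obtain ⟨f, t, hfO, hfC⟩ := geometric_hahn_banach_open hOc hO hCc hdisj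
  let w : F → ℝ := fun g => f (Pi.single g 1)
  have hf : ∀ v : F → ℝ, f v = ∑ g, v g * w g := fun v => by
    conv_lhs => rw [pi_eq_sum_univ' v, map_sum]
    refine Finset.sum_congr rfl fun g _ => ?_
    rw [map_smul, smul_eq_mul]
  have hcost : ∀ ξ : Γ → Γ → ℝ, (∀ g, IsProbOn K (ξ g)) →
      (fun g : F => (fieldCost S ξ g).toReal) ∈ C := fun ξ hξ =>
    ⟨fun g => ENNReal.toReal_nonneg, ξ, hξ, fun g =>
      (ENNReal.ofReal_toReal (fieldCost_ne_top hξ g)).ge⟩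
  have hw : ∀ g, 0 ≤ w g := by
    intro g
    obtain ⟨ξ, hξ, -⟩ := hW 0 (by simp)
    obtain ⟨h0, -, -, h1⟩ := hcost ξ hξ
    by_contra! hneg
    set v : F → ℝ := fun g => (fieldCost S ξ g).toReal
    have hmem : ∀ c : ℝ, 0 ≤ c → v + c • Pi.single g 1 ∈ C := fun c hc => by
      have hle : ∀ g', v g' ≤ (v + c • (Pi.single g 1 : F → ℝ)) g' := fun g' => by
        have : (0 : ℝ) ≤ (Pi.single g 1 : F → ℝ) g' := by
          rw [Pi.single_apply]
          split_ifs <;> norm_num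
        simpa using mul_nonneg hc this
      exact ⟨fun g' => (h0 g').trans (hle g'), ξ, hξ, fun g' =>
        (ENNReal.ofReal_toReal (fieldCost_ne_top hξ g')).ge.trans
          (ENNReal.ofReal_le_ofReal (hle g'))⟩
    have h2 : ∀ c : ℝ, 0 ≤ c → t ≤ f v + c * w g := fun c hc => by
      simpa [w] using hfC _ (hmem c hc)
    have h3 := h2 ((|f v - t| + 1) / (- w g)) (div_nonneg (by positivity) (by linarith))
    rw [div_neg, neg_mul, div_mul_cancel₀ _ hneg.ne] at h3
    linarith [le_abs_self (f v - t)]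
  let μ : Γ → ℝ≥0∞ := fun g => if h : g ∈ F then ENNReal.ofReal (w ⟨g, h⟩) else 0
  have hμ : ∀ g : F, μ g = ENNReal.ofReal (w g) := fun g => dif_pos g.2
  have hμsum : ∑' g, μ g = ENNReal.ofReal (∑ g, w g) := by
    rw [tsum_eq_sum (s := F) fun g hg => dif_neg hg, ← Finset.sum_coe_sort F μ,
      ENNReal.ofReal_sum_of_nonneg fun g _ => hw g]
    exact Finset.sum_congr rfl fun g _ => hμ g
  obtain ⟨ξ, hξ, hle⟩ := hW μ (by rw [hμsum]; exact ENNReal.ofReal_ne_top)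
  have h1 := hfC _ (hcost ξ hξ)
  have h2 := hfO (fun _ => ε / 2) fun _ => by linarith
  have h3 : ∑ g : F, (fieldCost S ξ g).toReal * w g ≤ ∑ g : F, ε / 2 * w g := by
    rw [← Finset.mul_sum]
    refine (ENNReal.ofReal_le_ofReal_iff (mul_nonneg (by positivity)
      (Finset.sum_nonneg fun g _ => hw g))).1 ?_
    rw [ENNReal.ofReal_mul (by positivity), ← hμsum]
    refine le_trans (le_of_eq ?_) hle
    rw [← Finset.sum_coe_sort F fun g => μ g * fieldCost S ξ g,
      ENNReal.ofReal_sum_of_nonneg fun g _ => mul_nonneg ENNReal.toReal_nonneg (hw g)]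
    refine Finset.sum_congr rfl fun g _ => ?_
    rw [ENNReal.ofReal_mul ENNReal.toReal_nonneg, ENNReal.ofReal_toReal (fieldCost_ne_top hξ g),
      hμ, mul_comm]
  rw [hf] at h1 h2
  linarith

end Minimax

section Compactness

theorem isCompact_isProbOn (K : Finset Γ) : IsCompact {p : Γ → ℝ | IsProbOn K p} := by
  have heq : {p : Γ → ℝ | IsProbOn K p} = (Set.univ.pi fun _ => Set.Icc 0 1) ∩
      ({p | ∀ x ∉ K, p x = 0} ∩ {p | ∑ x ∈ K, p x = 1}) := by
    ext p
    constructor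
    · intro hp
      have hsum : ∑ x ∈ K, p x = 1 := by rw [← hp.tsum_eq, tsum_eq_sum hp.eq_zero]
      refine ⟨fun x _ => ⟨hp.nonneg x, ?_⟩, hp.eq_zero, hsum⟩
      exact ((summable_of_tsum_eq_one hp.tsum_eq).le_tsum x fun y _ => hp.nonneg y).trans
        hp.tsum_eq.le
    · rintro ⟨h1, h2, h3⟩
      exact ⟨fun x => (h1 x trivial).1, h2, by rw [tsum_eq_sum h2]; exact h3⟩
  rw [heq]
  refine (isCompact_univ_pi fun _ => isCompact_Icc).inter_right (IsClosed.inter ?_ ?_)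
  · simp only [Set.ofPred_forall]
    exact isClosed_iInter fun x => isClosed_iInter fun _ =>
      isClosed_eq (continuous_apply x) continuous_const
  · exact isClosed_eq (continuous_finsetSum _ fun x _ => continuous_apply x) continuous_const

theorem lowerSemicontinuous_fieldCost (S : Finset Γ) (g : Γ) :
    LowerSemicontinuous fun ξ : Γ → Γ → ℝ => fieldCost S ξ g := by
  refine lowerSemicontinuous_sum fun s _ => lowerSemicontinuous_tsum fun x => ?_
  have h : Continuous fun ξ : Γ → Γ → ℝ => |ξ g (s * x) - ξ (g * s) x| := by fun_prop
  exact (ENNReal.continuous_ofReal.comp h).lowerSemicontinuous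

theorem isClosed_fieldCost_le (S : Finset Γ) (g : Γ) (c : ℝ≥0∞) :
    IsClosed {ξ : Γ → Γ → ℝ | fieldCost S ξ g ≤ c} :=
  (lowerSemicontinuous_fieldCost S g).isClosed_preimage c

theorem isCompact_forall_isProbOn (K : Finset Γ) :
    IsCompact {ξ : Γ → Γ → ℝ | ∀ g, IsProbOn K (ξ g)} := by
  have h := isCompact_univ_pi fun _ : Γ => isCompact_isProbOn K
  simpa [Set.pi] using h

theorem exists_forall_fieldCost_le [Countable Γ]
    (hcl : closure {ρ : ProbabilityMeasure (EqRelSpace Γ) | IsFIRE ρ} ⊆ {ρ | IsAIRE ρ})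
    (S : Finset Γ) {ε : ℝ} (hε : 0 < ε) :
    ∃ (K : Finset Γ) (ξ : Γ → Γ → ℝ), (∀ g, IsProbOn K (ξ g)) ∧
      ∀ g, fieldCost S ξ g ≤ ENNReal.ofReal ε := by
  obtain ⟨K, hK⟩ := exists_sum_mul_fieldCost_le hcl S (half_pos hε)
  obtain ⟨ξ, hξ, hcost⟩ := (isCompact_forall_isProbOn K).inter_iInter_nonempty
    (fun g => {ξ | fieldCost S ξ g ≤ ENNReal.ofReal ε})
    (fun g => isClosed_fieldCost_le S g _) fun F => by
      obtain ⟨ξ, hξ, h⟩ := exists_forall_mem_fieldCost_le (F := F) hε fun μ hμ => hK F μ hμ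
      exact ⟨ξ, hξ, Set.mem_iInter₂.2 h⟩
  exact ⟨K, ξ, hξ, fun g => Set.mem_iInter.1 hcost g⟩

end Compactness

section Exactness

/-- A field of probability vectors, translated by `γ`. -/
def shiftFields (γ : Γ) (x : ℕ → Γ → Γ → ℝ) : ℕ → Γ → Γ → ℝ := fun n g => x n (γ⁻¹ * g)

theorem continuous_shiftFields (γ : Γ) : Continuous (shiftFields γ) := by
  unfold shiftFields
  fun_prop

/-- Sequences of fields of probability vectors with prescribed supports and costs. -/
def fieldSpace (S K : ℕ → Finset Γ) : Set (ℕ → Γ → Γ → ℝ) :=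
  {x | ∀ n, (∀ g, IsProbOn (K n) (x n g)) ∧
    ∀ g, fieldCost (S n) (x n) g ≤ ENNReal.ofReal (1 / (n + 1))}

theorem isCompact_fieldSpace (S K : ℕ → Finset Γ) : IsCompact (fieldSpace S K) := by
  have h := isCompact_univ_pi fun n : ℕ => (isCompact_forall_isProbOn (K n)).inter_right
    (isClosed_iInter fun g => isClosed_fieldCost_le (S n) g (ENNReal.ofReal (1 / (n + 1))))
  convert h using 1
  ext x
  simp [fieldSpace]

theorem fieldCost_shift (S : Finset Γ) (ξ : Γ → Γ → ℝ) (γ g : Γ) :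
    fieldCost S (fun g => ξ (γ⁻¹ * g)) g = fieldCost S ξ (γ⁻¹ * g) := by
  simp only [fieldCost, mul_assoc]

theorem shiftFields_mem {S K : ℕ → Finset Γ} (γ : Γ) {x : ℕ → Γ → Γ → ℝ}
    (hx : x ∈ fieldSpace S K) : shiftFields γ x ∈ fieldSpace S K := fun n =>
  ⟨fun g => (hx n).1 (γ⁻¹ * g), fun g => (fieldCost_shift (S n) (x n) γ g).trans_le
    ((hx n).2 _)⟩

theorem tsum_abs_sub_le_of_mem_fieldSpace {S K : ℕ → Finset Γ} {x : ℕ → Γ → Γ → ℝ}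
    (hx : x ∈ fieldSpace S K) {γ : Γ} {n : ℕ} (hγ : γ⁻¹ ∈ S n) :
    ∑' k, |x n 1 (γ⁻¹ * k) - shiftFields γ x n 1 k| ≤ 1 / (n + 1) := by
  have h1 : shiftDist γ⁻¹ (x n 1) (x n (1 * γ⁻¹)) ≤ ENNReal.ofReal (1 / (n + 1)) :=
    (Finset.single_le_sum (f := fun s => shiftDist s (x n 1) (x n (1 * s)))
      (fun _ _ => bot_le) hγ).trans ((hx n).2 1)
  have h2 : γ⁻¹ * 1 = 1 * γ⁻¹ := by group
  have h3 : ∑' k, |x n 1 (γ⁻¹ * k) - shiftFields γ x n 1 k| =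
      (shiftDist γ⁻¹ (x n 1) (x n (1 * γ⁻¹))).toReal := by
    rw [shiftDist, ENNReal.tsum_toReal_eq fun _ => ENNReal.ofReal_ne_top]
    refine tsum_congr fun k => ?_
    rw [ENNReal.toReal_ofReal (abs_nonneg _), shiftFields, h2]
  rw [h3]
  exact ENNReal.toReal_le_of_le_ofReal (by positivity) h1

/-- Exactness may be witnessed in any universe by a space equivalent to a small one. -/
theorem isExactGroup_of_small {X : Type*} [TopologicalSpace X] [Small.{0} X] [Nonempty X]
    [CompactSpace X] [TopologicalSpace.MetrizableSpace X] (a : Γ → X → X)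
    (h_one : ∀ x, a 1 x = x) (h_mul : ∀ γ δ x, a (γ * δ) x = a γ (a δ x))
    (h_cont : ∀ γ, Continuous (a γ)) (h_amen : TopAmenableAction Γ a) : IsExactGroup Γ := by
  let e : Shrink.{0} X ≃ X := (equivShrink X).symm
  let t : TopologicalSpace (Shrink.{0} X) := TopologicalSpace.induced e inferInstance
  let h : Shrink.{0} X ≃ₜ X := e.toHomeomorphOfIsInducing ⟨rfl⟩
  obtain ⟨η, h0, h1, hc, hη⟩ := h_amen
  refine ⟨Shrink.{0} X, t, fun γ y => h.symm (a γ (h y)), h.toEquiv.nonempty,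
    h.symm.compactSpace, h.isEmbedding.metrizableSpace, fun y => by simp [h_one],
    fun γ δ y => by simp [h_mul], fun γ => h.symm.continuous.comp ((h_cont γ).comp h.continuous),
    fun n y => η n (h y), fun n y => h0 n _, fun n y => h1 n _,
    fun n g => (hc n g).comp h.continuous, fun γ ε hε => ?_⟩
  obtain ⟨N, hN⟩ := hη γ ε hε
  exact ⟨N, fun n hn y => by simpa using hN n hn (h y)⟩

theorem isExactGroup_of_closure_subset [Countable Γ]
    (hcl : closure {ρ : ProbabilityMeasure (EqRelSpace Γ) | IsFIRE ρ} ⊆ {ρ | IsAIRE ρ}) :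
    IsExactGroup Γ := by
  classical
  obtain ⟨e, he⟩ := exists_surjective_nat Γ
  let S : ℕ → Finset Γ := fun n => (Finset.range n).image e
  choose K ξ hξ hcost using fun n : ℕ =>
    exists_forall_fieldCost_le hcl (S n) (ε := 1 / (n + 1)) (by positivity)
  have hne : Nonempty (fieldSpace S K) := ⟨⟨ξ, fun n => ⟨hξ n, hcost n⟩⟩⟩
  have hcpt : CompactSpace (fieldSpace S K) := isCompact_iff_compactSpace.1
    (isCompact_fieldSpace S K)
  have hmet : TopologicalSpace.MetrizableSpace (fieldSpace S K) := inferInstance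
  have hsmall : Small.{0} (fieldSpace S K) := inferInstance
  refine isExactGroup_of_small (X := fieldSpace S K)
    (fun γ x => ⟨shiftFields γ x.1, shiftFields_mem γ x.2⟩) (fun x => ?_) (fun γ δ x => ?_)
    (fun γ => ?_) ⟨fun n x => x.1 n 1, fun n x => ((x.2 n).1 1).nonneg,
      fun n x => ((x.2 n).1 1).tsum_eq, fun n g => ?_, fun γ ε hε => ?_⟩
  · ext n g k
    simp [shiftFields]
  · ext n g k
    simp [shiftFields, mul_assoc]
  · exact ((continuous_shiftFields γ).comp continuous_subtype_val).subtype_mk _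
  · exact (continuous_apply_apply 1 g).comp ((continuous_apply n).comp continuous_subtype_val)
  · obtain ⟨m, hm⟩ := he γ⁻¹
    obtain ⟨N, hN⟩ := exists_nat_one_div_lt hε
    refine ⟨max N (m + 1), fun n hn x => ?_⟩
    have hmem : γ⁻¹ ∈ S n := Finset.mem_image.2
      ⟨m, Finset.mem_range.2 ((le_max_right N (m + 1)).trans hn), hm⟩
    refine (tsum_abs_sub_le_of_mem_fieldSpace x.2 hmem).trans_lt (lt_of_le_of_lt ?_ hN)
    have hNn : (N : ℝ) ≤ n := by exact_mod_cast (le_max_left N (m + 1)).trans hn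
    gcongr

end Exactness

theorem exact_iff_closure_FIRE_eq_AIRE {Γ : Type*} [Group Γ] [Countable Γ] :
    IsExactGroup Γ ↔
      closure {ρ : ProbabilityMeasure (EqRelSpace Γ) | IsFIRE ρ} = {ρ | IsAIRE ρ} := by
  refine ⟨fun h => h.closure_isFIRE_subset.antisymm fun ρ hρ => ?_,
    fun h => isExactGroup_of_closure_subset h.subset⟩
  exact IsAIRE.mem_closure_isFIRE hρ
end

section
/- Let Γ be a countable group acting by Borel automorphisms on a standard Borel space X, and let S ⊆ R_{Γ↷X} be a Borel subequivalence relation of the orbit equivalence relation. Suppose there exists a sequence of Borel maps η_n : X → Prob(Γ) such that for every x ∈ X and every γ ∈ Γ with (γ·x, x) ∈ S, we have ‖γ·η_n^x − η_n^{γ·x}‖₁ → 0 as n → ∞. Then S is Borel amenable. -/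
open MeasureTheory Filter Topology

/-- A countable Borel equivalence relation `S` on a measurable space `X` is Borel amenable:
there are Borel maps `η_n : S → ℝ≥0` (extended by `0` to `X × X`, with `η n x y` the mass that
`η_n^x := η_n(·,x)` puts at `y`) such that each `η_n^x` is a probability measure supported on
the `S`-class of `x` and `‖η_n^x − η_n^y‖₁ → 0` for all `(y,x) ∈ S`. -/
def BorelAmenableRel {X : Type*} [MeasurableSpace X] (S : X → X → Prop) : Prop :=
  ∃ η : ℕ → X → X → ℝ,
    (∀ n, Measurable fun p : X × X => η n p.1 p.2) ∧
    (∀ n x y, 0 ≤ η n x y) ∧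
    (∀ n x y, η n x y ≠ 0 → S y x) ∧
    (∀ n x, ∑' y : X, η n x y = 1) ∧
    ∀ x y, S y x → Tendsto (fun n => ∑' z : X, |η n x z - η n y z|) atTop (𝓝 0)

/-- Pushing forward along `τ` is nonexpansive for the `ℓ¹` norm. -/
theorem tsum_abs_fiber_sub_le {Γ X : Type*} (τ : Γ → X) {u v : Γ → ℝ}
    (hu : Summable u) (hv : Summable v) :
    ∑' z : X, |∑' g : τ ⁻¹' {z}, u g - ∑' g : τ ⁻¹' {z}, v g| ≤ ∑' g, |u g - v g| := by
  have hsum : Summable fun g => |u g - v g| := (hu.sub hv).abs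
  have hfib := hsum.hasSum.tsum_fiberwise τ
  have hle : ∀ z : X, |∑' g : τ ⁻¹' {z}, u g - ∑' g : τ ⁻¹' {z}, v g| ≤
      ∑' g : τ ⁻¹' {z}, |u g - v g| := fun z => by
    calc |∑' g : τ ⁻¹' {z}, u g - ∑' g : τ ⁻¹' {z}, v g|
        = |∑' g : τ ⁻¹' {z}, (u g - v g)| :=
          congrArg abs ((hu.subtype (τ ⁻¹' {z})).tsum_sub (hv.subtype (τ ⁻¹' {z}))).symm
      _ ≤ ∑' g : τ ⁻¹' {z}, |u g - v g| :=
          norm_tsum_le_tsum_norm (f := fun g : τ ⁻¹' {z} => u g - v g)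
            (hsum.comp_injective Subtype.val_injective)
  rw [← hfib.tsum_eq]
  exact (Summable.of_nonneg_of_le (fun _ => abs_nonneg _) hle hfib.summable).tsum_le_tsum hle
    hfib.summable

/-- The first point of the form `a (e i) y` lying in the `S`-class of `x`, if there is one. -/
noncomputable def firstPointInClass {Γ X : Type*} (a : Γ → X → X) (S : X → X → Prop)
    (e : ℕ → Γ) (x y : X) : X :=
  a (e (sInf {i | S (a (e i) y) x})) y

section FirstPoint

variable {Γ X : Type*} {a : Γ → X → X} {S : X → X → Prop} {e : ℕ → Γ}

theorem firstPointInClass_congr (hS : Equivalence S) {x x' : X} (h : S x x') (y : X) :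
    firstPointInClass a S e x y = firstPointInClass a S e x' y := by
  have hset : {i | S (a (e i) y) x} = {i | S (a (e i) y) x'} :=
    Set.ext fun _ => ⟨fun hi => hS.trans hi h, fun hi => hS.trans hi (hS.symm h)⟩
  simp only [firstPointInClass, hset]

theorem rel_firstPointInClass {x y : X} (h : ∃ i, S (a (e i) y) x) :
    S (firstPointInClass a S e x y) x :=
  Nat.sInf_mem (s := {i | S (a (e i) y) x}) h

theorem measurable_firstPointInClass [MeasurableSpace X] (ha : ∀ γ, Measurable (a γ))
    (hS : MeasurableSet {p : X × X | S p.1 p.2}) {f : X → X} (hf : Measurable f)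
    (h : ∀ x, ∃ i, S (a (e i) (f x)) x) :
    Measurable fun x => firstPointInClass a S e x (f x) := by
  classical
  have hfind : Measurable fun x => Nat.find (h x) :=
    measurable_find h fun i => (((ha (e i)).comp hf).prodMk measurable_id) hS
  have hpair : Measurable fun p : X × ℕ => a (e p.2) (f p.1) :=
    measurable_from_prod_countable_left fun i => (ha (e i)).comp hf
  convert hpair.comp (measurable_id.prodMk hfind) using 2 with x
  have hmin : sInf {i | S (a (e i) (f x)) x} = Nat.find (h x) := Nat.sInf_def (h x)
  simp only [firstPointInClass, Function.comp, id, hmin]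

end FirstPoint

/-- Lemma: if `S` is a Borel subequivalence relation of the orbit equivalence relation of a
Borel action `a` of a countable group `Γ` on a standard Borel space `X`, and there are Borel
maps `η_n : X → Prob(Γ)` (coded coordinatewise) with `‖γ·η_n^x − η_n^{γ·x}‖₁ → 0`
whenever `(γ·x, x) ∈ S` (where `(γ·η)(g) = η(γ⁻¹g)`), then `S` is Borel amenable. -/
theorem borelAmenable_of_asymptotically_invariant_maps
    {Γ X : Type*} [Group Γ] [Countable Γ] [MeasurableSpace X] [StandardBorelSpace X]
    (a : Γ → X → X)
    (hone : ∀ x, a 1 x = x) (hmul : ∀ γ δ x, a (γ * δ) x = a γ (a δ x))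
    (hameas : ∀ γ, Measurable (a γ))
    (S : X → X → Prop) (hSeq : Equivalence S)
    (hSBorel : MeasurableSet {p : X × X | S p.1 p.2})
    (hsub : ∀ x y, S x y → ∃ γ : Γ, a γ x = y)
    (η : ℕ → X → Γ → ℝ)
    (hηmeas : ∀ n g, Measurable fun x => η n x g)
    (hηpos : ∀ n x g, 0 ≤ η n x g)
    (hηsum : ∀ n x, ∑' g : Γ, η n x g = 1)
    (hconv : ∀ (x : X) (γ : Γ), S (a γ x) x →
      Tendsto (fun n => ∑' g : Γ, |η n x (γ⁻¹ * g) - η n (a γ x) g|) atTop (𝓝 0)) :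
    BorelAmenableRel S := by
  classical
  obtain ⟨e, he⟩ := exists_surjective_nat Γ
  have hinv : ∀ γ x, a γ⁻¹ (a γ x) = x := fun γ x => by rw [← hmul, inv_mul_cancel, hone]
  have hinv' : ∀ γ x, a γ (a γ⁻¹ x) = x := fun γ x => by rw [← hmul, mul_inv_cancel, hone]
  have hex : ∀ g x, ∃ i, S (a (e i) (a g⁻¹ x)) x := fun g x => by
    obtain ⟨i, hi⟩ := he g
    exact ⟨i, by rw [hi, hinv']; exact hSeq.refl x⟩
  have hηsummable : ∀ n x, Summable (η n x) := fun n x => by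
    by_contra h
    simpa [tsum_eq_zero_of_not_summable h] using hηsum n x
  let τ : X → Γ → X := fun x g => firstPointInClass a S e x (a g⁻¹ x)
  have hτmeas : ∀ g, Measurable fun x => τ x g := fun g =>
    measurable_firstPointInClass hameas hSBorel (hameas g⁻¹) (hex g)
  refine ⟨fun n x z => ∑' g : τ x ⁻¹' {z}, η n x g, fun n => ?_, fun n x z => ?_,
    fun n x z hne => ?_, fun n x => ?_, fun x y hyx => ?_⟩
  · simp only [tsum_subtype (τ _ ⁻¹' {_}) (η n _)]
    refine Measurable.tsum fun g => ?_
    simp only [Set.indicator_apply, Set.mem_preimage, Set.mem_singleton_iff]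
    exact Measurable.ite
      (measurableSet_eq_fun ((hτmeas g).comp measurable_fst) measurable_snd)
      ((hηmeas n g).comp measurable_fst) measurable_const
  · exact tsum_nonneg fun g => hηpos n x g
  · obtain ⟨g, hg⟩ : ∃ g, τ x g = z := by
      by_contra! h
      have : IsEmpty (τ x ⁻¹' {z}) := ⟨fun g => h g g.2⟩
      exact hne tsum_empty
    exact hg ▸ rel_firstPointInClass (hex g x)
  · rw [((hηsummable n x).hasSum.tsum_fiberwise (τ x)).tsum_eq, hηsum]
  · obtain ⟨γ, rfl⟩ := hsub x y (hSeq.symm hyx)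
    have hτ : ∀ h, τ (a γ x) (γ * h) = τ x h := fun h => by
      simp only [τ, mul_inv_rev, hmul, hinv]
      exact firstPointInClass_congr hSeq hyx _
    refine squeeze_zero (fun n => tsum_nonneg fun z => abs_nonneg _) (fun n => ?_)
      (hconv x γ hyx)
    have hshift : ∀ z, ∑' g : τ (a γ x) ⁻¹' {z}, η n (a γ x) g =
        ∑' h : τ x ⁻¹' {z}, η n (a γ x) (γ * h) := fun z => by
      rw [tsum_subtype (τ (a γ x) ⁻¹' {z}) (η n (a γ x)),
        tsum_subtype (τ x ⁻¹' {z}) fun h => η n (a γ x) (γ * h),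
        ← (Equiv.mulLeft γ).tsum_eq]
      simp [Set.indicator_apply, hτ]
    simp only [hshift]
    refine (tsum_abs_fiber_sub_le (τ x) (hηsummable n x)
      ((Equiv.mulLeft γ).summable_iff.2 (hηsummable n (a γ x)))).trans_eq ?_
    rw [← (Equiv.mulLeft γ).tsum_eq fun g => |η n x (γ⁻¹ * g) - η n (a γ x) g|]
    simp
end

section
/- Let Γ be a countable discrete group, ρ an IRE on Γ, Ξ a nonempty Polish space with a topologically amenable continuous action of Γ, and ρ̃ a classwise coherent Ξ-marking of ρ. Then there exist Borel maps ξ_n : E × Ξ^Γ → Prob(Γ) such that for ρ̃-almost every (r, f) and every g ∈ [e]_r, ‖g⁻¹·ξ_n^{(r,f)} − ξ_n^{g⁻¹·(r,f)}‖₁ → 0 as n → ∞. -/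
open MeasureTheory Filter Topology

variable {Γ : Type*} [Group Γ]

/-- A classwise coherent `Ξ`-marking of an IRE `ρ`, for an action `a : Γ → Ξ → Ξ`:
a `Γ`-invariant Borel probability measure on `E × Ξ^Γ` (for the diagonal action, where
`Γ` acts on `Ξ^Γ` by `(γ·f)(x) = f(γ⁻¹x)`) projecting to `ρ`, such that almost surely
`g·(f(g)) = h·(f(h))` for every pair `(g,h)` in the relation. -/
def IsCCMarking {Γ : Type*} [Group Γ] {Ξ : Type*} [MeasurableSpace Ξ] (a : Γ → Ξ → Ξ)
    (ρ : ProbabilityMeasure (EqRelSpace Γ))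
    (ρ' : ProbabilityMeasure (EqRelSpace Γ × (Γ → Ξ))) : Prop :=
  (∀ γ : Γ, ρ'.toMeasure.map
      (fun p => (shiftE γ p.1, fun x => p.2 (γ⁻¹ * x))) = ρ'.toMeasure) ∧
  ρ'.toMeasure.map Prod.fst = ρ.toMeasure ∧
  ∀ᵐ p ∂ρ'.toMeasure, ∀ g h : Γ, p.1.1 (g, h) = true → a g (p.2 g) = a h (p.2 h)

/-- Proposition: if `ρ̃` is a classwise coherent `Ξ`-marking of an IRE `ρ` for a
topologically amenable action on a nonempty Polish space `Ξ`, then there exist Borel maps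
`ξ_n : E × Ξ^Γ → Prob(Γ)` that are asymptotically invariant along the (restricted
rerooting) classes: for `ρ̃`-a.e. `(r,f)` and every `g ∈ [e]_r`,
`‖g⁻¹·ξ_n^{(r,f)} − ξ_n^{g⁻¹·(r,f)}‖₁ → 0`. -/
theorem asymptotically_invariant_maps_of_CCMarking
    {Γ : Type*} [Group Γ] [Countable Γ]
    {Ξ : Type*} [TopologicalSpace Ξ] [PolishSpace Ξ] [MeasurableSpace Ξ] [BorelSpace Ξ]
    [Nonempty Ξ]
    (a : Γ → Ξ → Ξ)
    (hone : ∀ x, a 1 x = x) (hmul : ∀ γ δ x, a (γ * δ) x = a γ (a δ x))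
    (hcont : ∀ γ, Continuous (a γ)) (hta : TopAmenableAction Γ a)
    (ρ : ProbabilityMeasure (EqRelSpace Γ)) (hρ : IsIRE ρ)
    (ρ' : ProbabilityMeasure (EqRelSpace Γ × (Γ → Ξ))) (hcc : IsCCMarking a ρ ρ') :
    ∃ ξ : ℕ → EqRelSpace Γ × (Γ → Ξ) → Γ → ℝ,
      (∀ n g, Measurable fun p => ξ n p g) ∧
      (∀ n p g, 0 ≤ ξ n p g) ∧
      (∀ n p, ∑' g, ξ n p g = 1) ∧
      ∀ᵐ p ∂ρ'.toMeasure, ∀ g ∈ classOf p.1 1,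
        Tendsto (fun n => ∑' h : Γ,
            |ξ n p (g * h) - ξ n (shiftE g⁻¹ p.1, fun x => p.2 (g * x)) h|)
          atTop (𝓝 0) := by
  obtain ⟨η, hη0, hη1, hηc, hη⟩ := hta
  refine ⟨fun n p g => η n (p.2 1) g, fun n g => ?_, fun n p g => hη0 n _ g, fun n p => hη1 n _, ?_⟩
  · exact (hηc n g).measurable.comp ((measurable_pi_apply 1).comp measurable_snd)
  filter_upwards [hcc.2.2] with p hp g hg
  have hmark : p.2 (g * 1) = a g⁻¹ (p.2 1) := by
    have h := hp 1 g hg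
    rw [hone] at h
    rw [h, ← hmul, inv_mul_cancel, hone, mul_one]
  rw [Metric.tendsto_atTop]
  intro ε hε
  obtain ⟨N, hN⟩ := hη g⁻¹ ε hε
  refine ⟨N, fun n hn => ?_⟩
  have h := hN n hn (p.2 1)
  rw [inv_inv] at h
  rw [Real.dist_eq, sub_zero, abs_of_nonneg (tsum_nonneg fun _ => abs_nonneg _)]
  simpa only [hmark] using h
end
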